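/- For all integers k ≥ 3, m ≥ k+1, and n ≥ 1 such that 2k divides n, there is no party-approval rule for n voters, m parties, and committee size k that simultaneously satisfies anonymity, weak representation, and strategyproofness. -/

import Mathlib

/-- An approval profile is valid if every voter's ballot is nonempty. -/
def ValidProfile {P : Type*} (n : ℕ) (A : Fin n → Finset P) : Prop :=
  ∀ i, (A i).Nonempty

/-- The number of seats a committee `W` assigns to the parties in `X`. -/
def seats {P : Type*} [DecidableEq P] (W : Multiset P) (X : Finset P) : ℕ :=
  ∑ x ∈ X, W.count x

/-- A party-approval rule for `n` voters and committee size `k`: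
it assigns to every (valid) approval profile a committee of size `k`. -/
def IsPAPPRule {P : Type*} (n k : ℕ) (f : (Fin n → Finset P) → Multiset P) : Prop :=
  ∀ A, ValidProfile n A → Multiset.card (f A) = k

/-- Anonymity: permuting the voters does not change the outcome. -/
def Anonymous {P : Type*} (n : ℕ) (f : (Fin n → Finset P) → Multiset P) : Prop :=
  ∀ A, ValidProfile n A → ∀ π : Equiv.Perm (Fin n), f (fun i => A (π i)) = f A

/-- Weak representation: a party uniquely approved by at least `n / k` voters
gets at least one seat. -/
def WeakRep {P : Type*} [DecidableEq P] (n k : ℕ)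
    (f : (Fin n → Finset P) → Multiset P) : Prop :=
  ∀ A, ValidProfile n A → ∀ (x : P) (G : Finset (Fin n)),
    n ≤ k * G.card → (∀ i ∈ G, A i = {x}) → 1 ≤ (f A).count x

/-- Weak proportional representation: a party uniquely approved by at least
`ℓ * n / k` voters gets at least `ℓ` seats. -/
def WeakPropRep {P : Type*} [DecidableEq P] (n k : ℕ)
    (f : (Fin n → Finset P) → Multiset P) : Prop :=
  ∀ A, ValidProfile n A → ∀ (x : P) (G : Finset (Fin n)) (ℓ : ℕ),
    1 ≤ ℓ → ℓ * n ≤ k * G.card → (∀ i ∈ G, A i = {x}) → ℓ ≤ (f A).count x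

/-- Strategyproofness: no voter can increase the number of seats assigned to
her approved parties by misreporting her ballot. -/
def Strategyproof {P : Type*} [DecidableEq P] (n : ℕ)
    (f : (Fin n → Finset P) → Multiset P) : Prop :=
  ∀ A A' : Fin n → Finset P, ValidProfile n A → ValidProfile n A' →
    ∀ i : Fin n, (∀ j, j ≠ i → A j = A' j) →
      seats (f A') (A i) ≤ seats (f A) (A i)

/-! ### Reduction to six voters, four parties and three seats

A ballot over the parties `0, 1, 2, 3` is coded by the natural number below `16` whose binary
digits are its indicator function. A profile of six ballots is the list of their codes, and a
committee of size three by the natural number whose base-four digit at position `X` is the number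
of its seats that go to parties in the ballot coded by `X`. -/

/-- The number of seats that the committee coded by `c` assigns to the ballot coded by `X`. -/
def codedSeats (c X : ℕ) : ℕ := Nat.mod (Nat.shiftRight c (Nat.mul 2 X)) 4

/-- The codes of the twenty committees of size three over four parties. -/
def committeeCodes : List ℕ :=
  [4294901760, 4289352960, 4283804160, 4278255360, 4210708560,
    4205159760, 4199610960, 4126515360, 4120966560, 4042322160,
    4008592452, 4003043652, 3997494852, 3924399252, 3918850452,
    3840206052, 3722283144, 3716734344, 3638089944, 3435973836]

/-- The seat counts `s p X` that a strategyproof and weakly representative rule for six voters,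
four parties and three seats assigns to the ballot `X` in the profile `p`. -/
structure IsSeatFunction (s : List ℕ → ℕ → ℕ) : Prop where
  perm : ∀ p q, p.Perm q → s p = s q
  strategyproof : ∀ p X Y, p.length = 5 → X < 16 → s (Y :: p) X ≤ s (X :: p) X
  weakRep : ∀ p, ∀ x ∈ [1, 2, 4, 8], p.length = 4 → 1 ≤ s (x :: x :: p) x
  committee : ∀ p, p.length = 6 → ∃ c ∈ committeeCodes, ∀ X < 16, s p X = codedSeats c X

/-- The ballot coded by `x` consists of a single party. -/
def isParty (x : ℕ) : Bool := Nat.beq x 1 || Nat.beq x 2 || Nat.beq x 4 || Nat.beq x 8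

theorem mem_of_isParty {x : ℕ} (hx : isParty x = true) : x ∈ [1, 2, 4, 8] := by
  simpa [isParty, or_assoc] using hx

/-- Renaming the four parties: `a`, `b`, `c`, `d` are the codes of the singletons that contain the
new names of the parties. -/
structure Relabeling where
  a : ℕ
  b : ℕ
  c : ℕ
  d : ℕ

namespace Relabeling

/-- The effect of a relabeling on ballots. -/
def ballot (t : Relabeling) (X : ℕ) : ℕ :=
  Nat.add (Nat.add (Nat.mul (Nat.mod X 2) t.a) (Nat.mul (Nat.mod (Nat.div X 2) 2) t.b))
    (Nat.add (Nat.mul (Nat.mod (Nat.div X 4) 2) t.c) (Nat.mul (Nat.div X 8) t.d))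

/-- The new names are four distinct parties. -/
def isValid (t : Relabeling) : Bool :=
  isParty t.a && isParty t.b && isParty t.c && isParty t.d &&
    Nat.beq (t.a + t.b + t.c + t.d) 15

theorem ballot_spec :
    ∀ a ∈ [1, 2, 4, 8], ∀ b ∈ [1, 2, 4, 8], ∀ c ∈ [1, 2, 4, 8], ∀ d ∈ [1, 2, 4, 8],
      a + b + c + d = 15 →
        (∀ X < 16, ballot ⟨a, b, c, d⟩ X < 16) ∧
        (∀ x ∈ [1, 2, 4, 8], ballot ⟨a, b, c, d⟩ x ∈ [1, 2, 4, 8]) ∧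
        ∀ c₁ ∈ committeeCodes, ∃ c₂ ∈ committeeCodes, ∀ X < 16,
          codedSeats c₁ (ballot ⟨a, b, c, d⟩ X) = codedSeats c₂ X := by
  decide +kernel

end Relabeling

theorem IsSeatFunction.relabel {s : List ℕ → ℕ → ℕ} (hs : IsSeatFunction s) {t : Relabeling}
    (ht : t.isValid = true) : IsSeatFunction fun p X => s (p.map t.ballot) (t.ballot X) := by
  simp only [Relabeling.isValid, Bool.and_eq_true] at ht
  obtain ⟨⟨⟨⟨ha, hb⟩, hc⟩, hd⟩, hsum⟩ := ht
  replace hsum := Nat.eq_of_beq_eq_true hsum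
  obtain ⟨hlt, hsing, hcomm⟩ := Relabeling.ballot_spec _ (mem_of_isParty ha) _ (mem_of_isParty hb)
    _ (mem_of_isParty hc) _ (mem_of_isParty hd) hsum
  refine ⟨fun p q h => ?_, fun p X Y hp hX => ?_, fun p x hx hp => ?_, fun p hp => ?_⟩
  · rw [hs.perm _ _ (h.map _)]
  · exact hs.strategyproof _ _ _ (by simpa using hp) (hlt X hX)
  · exact hs.weakRep _ _ (hsing x hx) (by simpa using hp)
  · obtain ⟨c₁, hc₁, h₁⟩ := hs.committee (p.map t.ballot) (by simpa using hp)
    obtain ⟨c₂, hc₂, h₂⟩ := hcomm c₁ hc₁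
    exact ⟨c₂, hc₂, fun X hX => (h₁ _ (hlt X hX)).trans (h₂ X hX)⟩

/-! ### A checker for refutations by propagation -/

/-- The claim that the parties in `ballot` get at least `bound` seats in `profile`. -/
structure SeatBound where
  profile : List ℕ
  ballot : ℕ
  bound : ℕ

/-- A disjunction of seat bounds. -/
abbrev SeatClause := List SeatBound

def SeatBound.Holds (s : List ℕ → ℕ → ℕ) (l : SeatBound) : Prop :=
  l.bound ≤ s l.profile l.ballot

def SeatClause.Holds (s : List ℕ → ℕ → ℕ) (C : SeatClause) : Prop :=
  ∃ l ∈ C, l.Holds s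

/-- A clause is valid if it holds for every strategyproof and weakly representative rule. -/
def SeatClause.IsValid (C : SeatClause) : Prop :=
  ∀ s, IsSeatFunction s → C.Holds s

/-- Insertion into a sorted list. -/
def insertSorted (x : ℕ) : List ℕ → List ℕ
  | [] => [x]
  | y :: l => bif Nat.ble x y then x :: y :: l else y :: insertSorted x l

theorem insertSorted_perm (x : ℕ) (l : List ℕ) : (insertSorted x l).Perm (x :: l) := by
  induction l with
  | nil => exact .refl _
  | cons y l ih =>
    rw [insertSorted]
    cases Nat.ble x y
    · exact (ih.cons y).trans (.swap _ _ _)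
    · exact .refl _

theorem foldr_insertSorted_perm (l : List ℕ) : (l.foldr insertSorted []).Perm l := by
  induction l with
  | nil => exact .refl _
  | cons x l ih => exact (insertSorted_perm _ _).trans (ih.cons x)

def SeatBound.relabel (t : Relabeling) (l : SeatBound) : SeatBound :=
  ⟨(l.profile.map t.ballot).foldr insertSorted [], t.ballot l.ballot, l.bound⟩

theorem SeatClause.IsValid.relabel {C : SeatClause} (hC : C.IsValid) {t : Relabeling}
    (ht : t.isValid = true) : SeatClause.IsValid (C.map (SeatBound.relabel t)) := by
  intro s hs
  obtain ⟨l, hl, h⟩ := hC _ (hs.relabel ht)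
  refine ⟨_, List.mem_map_of_mem hl, ?_⟩
  unfold SeatBound.Holds SeatBound.relabel
  rw [hs.perm _ _ (foldr_insertSorted_perm _)]
  exact h

/-- Boolean equality of profiles. -/
def eqProfile : List ℕ → List ℕ → Bool
  | [], [] => true
  | x :: p, y :: q => bif Nat.beq x y then eqProfile p q else false
  | _, _ => false

theorem eq_of_eqProfile : ∀ {p q : List ℕ}, eqProfile p q = true → p = q
  | [], [], _ => rfl
  | x :: p, y :: q, h => by
    rw [eqProfile] at h
    cases hxy : Nat.beq x y
    · simp [hxy] at h
    · rw [hxy] at h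
      rw [Nat.eq_of_beq_eq_true hxy, eq_of_eqProfile h]

/-- The committees that weak representation admits in the profile `p`. -/
def initialDomain (p : List ℕ) : List ℕ :=
  [1, 2, 4, 8].foldr (fun x D => bif Nat.ble 2 (p.countP (Nat.beq x)) then
    D.filter fun c => Nat.ble 1 (codedSeats c x) else D) committeeCodes

/-- For some profiles, the codes of the committees that may still be chosen. -/
abbrev Domains := List (List ℕ × List ℕ)

/-- The committee chosen in the profile `p` has its code in `D`. -/
def InDomain (s : List ℕ → ℕ → ℕ) (p D : List ℕ) : Prop :=
  ∃ c ∈ D, ∀ X < 16, s p X = codedSeats c X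

def Domains.Sound (s : List ℕ → ℕ → ℕ) (S : Domains) : Prop :=
  ∀ e ∈ S, e.1.length = 6 ∧ InDomain s e.1 e.2

/-- Discard the committees that do not satisfy `f` from the domain of the profile `p`. -/
def Domains.refine (p : List ℕ) (f : ℕ → Bool) : Domains → Domains
  | [] => [(p, (initialDomain p).filter f)]
  | e :: S => bif eqProfile e.1 p then (e.1, e.2.filter f) :: S else e :: Domains.refine p f S

theorem InDomain.filter {s : List ℕ → ℕ → ℕ} {p D : List ℕ} {f : ℕ → Bool} (h : InDomain s p D)
    (hf : ∀ c, (∀ X < 16, s p X = codedSeats c X) → f c = true) : InDomain s p (D.filter f) := by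
  obtain ⟨c, hc, h⟩ := h
  exact ⟨c, List.mem_filter.2 ⟨hc, hf c h⟩, h⟩

theorem IsSeatFunction.inDomain_initialDomain {s : List ℕ → ℕ → ℕ} (hs : IsSeatFunction s)
    {p : List ℕ} (hp : p.length = 6) : InDomain s p (initialDomain p) := by
  refine List.foldrRecOn [1, 2, 4, 8] _ (hs.committee p hp) fun D hD x hx => ?_
  have hx16 : x < 16 := (show ∀ x ∈ [1, 2, 4, 8], x < 16 by decide) x hx
  cases hcount : Nat.ble 2 (p.countP (Nat.beq x))
  · exact hD
  refine hD.filter fun c hc => ?_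
  have hsub : (List.replicate 2 x).Sublist p := by
    rw [List.replicate_sublist_iff, ← Nat.ble_eq, List.count_eq_countP]
    convert hcount using 3
    funext y
    rw [Bool.eq_iff_iff, beq_iff_eq, Nat.beq_eq, eq_comm]
  obtain ⟨q, hq⟩ := hsub.exists_perm_append
  have hq' : p.Perm (x :: x :: q) := hq
  have hlen := hq'.length_eq
  rw [Nat.ble_eq, ← hc x hx16, hs.perm _ _ hq']
  exact hs.weakRep q x hx (by simp at hlen; omega)

theorem Domains.Sound.refine {s : List ℕ → ℕ → ℕ} (hs : IsSeatFunction s) {p : List ℕ}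
    {f : ℕ → Bool} (hp : p.length = 6)
    (hf : ∀ c, (∀ X < 16, s p X = codedSeats c X) → f c = true) {S : Domains} (hS : S.Sound s) :
    (S.refine p f).Sound s := by
  induction S with
  | nil =>
    intro e he
    rw [Domains.refine, List.mem_singleton] at he
    subst he
    exact ⟨hp, (hs.inDomain_initialDomain hp).filter hf⟩
  | cons e S ih =>
    have hcons := List.forall_mem_cons.1 hS
    rw [Domains.refine]
    cases hep : eqProfile e.1 p
    · exact List.forall_mem_cons.2 ⟨hcons.1, ih hcons.2⟩
    · obtain rfl := eq_of_eqProfile hep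
      exact List.forall_mem_cons.2 ⟨⟨hp, hcons.1.2.filter hf⟩, hcons.2⟩

/-- The domain of the profile `p`. -/
def Domains.domain (p : List ℕ) : Domains → List ℕ
  | [] => initialDomain p
  | e :: S => bif eqProfile e.1 p then e.2 else Domains.domain p S

theorem Domains.Sound.inDomain {s : List ℕ → ℕ → ℕ} (hs : IsSeatFunction s) {p : List ℕ}
    (hp : p.length = 6) {S : Domains} (hS : S.Sound s) : InDomain s p (S.domain p) := by
  induction S with
  | nil => exact hs.inDomain_initialDomain hp
  | cons e S ih =>
    have hcons := List.forall_mem_cons.1 hS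
    rw [Domains.domain]
    cases hep : eqProfile e.1 p
    · exact ih hcons.2
    · obtain rfl := eq_of_eqProfile hep
      exact hcons.1.2

/-- The committee coded by `c` satisfies the seat bound `l`. -/
def SeatBound.test (l : SeatBound) (c : ℕ) : Bool := Nat.ble l.bound (codedSeats c l.ballot)

/-- The profile and the ballot of a seat bound are within range. -/
def SeatBound.inRange (l : SeatBound) : Bool :=
  Nat.beq l.profile.length 6 && Nat.ble l.ballot 15

theorem SeatBound.test_eq_true {l : SeatBound} (hl : l.inRange = true) {s : List ℕ → ℕ → ℕ}
    {c : ℕ} (hc : ∀ X < 16, s l.profile X = codedSeats c X) :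
    l.test c = true ↔ l.Holds s := by
  rw [inRange, Bool.and_eq_true, Nat.ble_eq] at hl
  rw [test, Nat.ble_eq, Holds, hc _ (by omega)]

theorem SeatBound.length_profile {l : SeatBound} (hl : l.inRange = true) :
    l.profile.length = 6 := by
  rw [inRange, Bool.and_eq_true] at hl
  exact Nat.eq_of_beq_eq_true hl.1

/-- Propagation steps. `move i X Y` applies strategyproofness to the voter who reports `X` in the
`i`-th profile under consideration and `Y` in another one; `cite i t` uses the `i`-th last clause
after relabeling the parties. -/
inductive PropagationStep
  | move (i X Y : ℕ)
  | cite (i a b c d : ℕ)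

/-- Propagate through a clause that is known to hold. -/
def Domains.propagate (C : SeatClause) (S : Domains) : Domains :=
  bif C.all SeatBound.inRange then
    match C.filter fun l => (S.domain l.profile).any l.test with
    | [] => [([], [])]
    | [l] => S.refine l.profile l.test
    | _ => S
  else S

/-- Carry out a propagation step. -/
def Domains.step (known : List SeatClause) (S : Domains) : PropagationStep → Domains
  | .move i X Y =>
    match S[i]? with
    | none => S
    | some (p, D) =>
      bif p.elem X && Nat.ble X 15 && Nat.ble Y 15 then
        S.refine (insertSorted Y (p.erase X)) fun d =>
          D.any fun c => Nat.ble (codedSeats d X) (codedSeats c X) &&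
            Nat.ble (codedSeats c Y) (codedSeats d Y)
      else S
  | .cite i a b c d =>
    match known[i]? with
    | none => S
    | some C =>
      bif Relabeling.isValid ⟨a, b, c, d⟩ then
        S.propagate (C.map (SeatBound.relabel ⟨a, b, c, d⟩))
      else S

theorem Domains.Sound.propagate {s : List ℕ → ℕ → ℕ} (hs : IsSeatFunction s) {C : SeatClause}
    (hC : C.Holds s) {S : Domains} (hS : S.Sound s) : (S.propagate C).Sound s := by
  unfold Domains.propagate
  cases hrange : C.all SeatBound.inRange
  · exact hS
  rw [List.all_eq_true] at hrange
  obtain ⟨l, hl, hls⟩ := hC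
  have hmem : l ∈ C.filter fun l => (S.domain l.profile).any l.test := by
    obtain ⟨c, hc, h⟩ := hS.inDomain hs (SeatBound.length_profile (hrange l hl))
    exact List.mem_filter.2
      ⟨hl, List.any_eq_true.2 ⟨c, hc, (SeatBound.test_eq_true (hrange l hl) h).2 hls⟩⟩
  rw [cond_true]
  split
  case h_1 heq => rw [heq] at hmem; exact absurd hmem List.not_mem_nil
  case h_2 l' heq =>
    rw [heq, List.mem_singleton] at hmem
    subst hmem
    exact hS.refine hs (SeatBound.length_profile (hrange l hl))
      fun c hc => (SeatBound.test_eq_true (hrange l hl) hc).2 hls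
  case h_3 => exact hS

theorem Domains.Sound.step {s : List ℕ → ℕ → ℕ} (hs : IsSeatFunction s)
    {known : List SeatClause} (hknown : ∀ C ∈ known, C.IsValid) {S : Domains} (hS : S.Sound s)
    (σ : PropagationStep) : (S.step known σ).Sound s := by
  cases σ with
  | move i X Y =>
    rw [Domains.step]
    split
    case h_1 => exact hS
    case h_2 p D heq =>
      obtain ⟨hlen, c, hc, h⟩ := hS _ (List.mem_of_getElem? heq)
      cases hcond : p.elem X && Nat.ble X 15 && Nat.ble Y 15
      · exact hS
      simp only [Bool.and_eq_true, Nat.ble_eq, List.elem_eq_mem, decide_eq_true_eq] at hcond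
      obtain ⟨⟨hXp, hX⟩, hY⟩ := hcond
      have hp := List.perm_cons_erase hXp
      have hq := insertSorted_perm Y (p.erase X)
      have hlen' : (p.erase X).length = 5 := by
        rw [List.length_erase_of_mem hXp, hlen]
      refine hS.refine hs (by rw [hq.length_eq, List.length_cons, hlen']) fun d hd => ?_
      refine List.any_eq_true.2 ⟨c, hc, ?_⟩
      rw [Bool.and_eq_true, Nat.ble_eq, Nat.ble_eq, ← h X (by omega), ← h Y (by omega),
        ← hd X (by omega), ← hd Y (by omega), hs.perm _ _ hp, hs.perm _ _ hq]
      exact ⟨hs.strategyproof _ _ _ hlen' (by omega), hs.strategyproof _ _ _ hlen' (by omega)⟩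
  | cite i a b c d =>
    rw [Domains.step]
    split
    case h_1 => exact hS
    case h_2 C heq =>
      cases ht : Relabeling.isValid ⟨a, b, c, d⟩
      · exact hS
      · exact hS.propagate hs ((hknown C (List.mem_of_getElem? heq)).relabel ht s hs)

/-- Some profile has no committee left. -/
def Domains.contradictory (S : Domains) : Bool := S.any fun e => e.2.isEmpty

theorem Domains.Sound.contradictory_eq_false {s : List ℕ → ℕ → ℕ} {S : Domains}
    (hS : S.Sound s) : S.contradictory = false := by
  rw [Domains.contradictory, List.any_eq_false]
  intro e he
  obtain ⟨-, c, hc, -⟩ := hS e he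
  rw [List.isEmpty_iff]
  exact List.ne_nil_of_mem hc

/-- The propagation steps lead to a contradiction. -/
def Domains.refutes (known : List SeatClause) : List PropagationStep → Domains → Bool
  | [], S => S.contradictory
  | σ :: l, S => bif S.contradictory then true else Domains.refutes known l (S.step known σ)

theorem Domains.Sound.refutes_eq_false {s : List ℕ → ℕ → ℕ} (hs : IsSeatFunction s)
    {known : List SeatClause} (hknown : ∀ C ∈ known, C.IsValid) (l : List PropagationStep)
    {S : Domains} (hS : S.Sound s) : S.refutes known l = false := by
  induction l generalizing S with
  | nil => exact hS.contradictory_eq_false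
  | cons σ l ih =>
    rw [Domains.refutes, hS.contradictory_eq_false]
    exact ih (hS.step hs hknown σ)

/-- The domains under the assumption that all bounds of a clause fail. -/
def SeatClause.negation : SeatClause → Domains
  | [] => []
  | l :: C => Domains.refine l.profile (fun c => !l.test c) (SeatClause.negation C)

theorem SeatClause.sound_negation {s : List ℕ → ℕ → ℕ} (hs : IsSeatFunction s) :
    ∀ {C : SeatClause}, C.all SeatBound.inRange = true → ¬ C.Holds s → C.negation.Sound s
  | [], _, _ => fun _ he => absurd he List.not_mem_nil
  | l :: C, hrange, hC => by
    rw [List.all_cons, Bool.and_eq_true] at hrange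
    refine Domains.Sound.refine hs (SeatBound.length_profile hrange.1) (fun c hc => ?_)
      (sound_negation hs hrange.2 fun ⟨l', hl', h⟩ => hC ⟨l', List.mem_cons_of_mem _ hl', h⟩)
    rw [Bool.not_eq_true', ← Bool.not_eq_true, SeatBound.test_eq_true hrange.1 hc]
    exact fun h => hC ⟨l, List.mem_cons_self, h⟩

/-- Check a list of clauses that are each refuted by propagation from the previous ones, the empty
clause being among them. -/
def checkRefutation (known : List SeatClause) : List (SeatClause × List PropagationStep) → Bool
  | [] => known.any List.isEmpty
  | (C, l) :: cert =>
    bif C.all SeatBound.inRange && C.negation.refutes known l then checkRefutation (C :: known) cert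
    else false

theorem not_isSeatFunction_of_checkRefutation (cert : List (SeatClause × List PropagationStep))
    {known : List SeatClause} (hknown : ∀ C ∈ known, C.IsValid)
    (h : checkRefutation known cert = true) (s : List ℕ → ℕ → ℕ) : ¬ IsSeatFunction s := by
  induction cert generalizing known with
  | nil =>
    intro hs
    obtain ⟨C, hC, hnil⟩ := List.any_eq_true.1 h
    obtain ⟨l, hl, -⟩ := hknown C hC s hs
    rw [List.isEmpty_iff.1 hnil] at hl
    exact List.not_mem_nil hl
  | cons e cert ih =>
    obtain ⟨C, l⟩ := e
    rw [checkRefutation] at h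
    cases hcond : C.all SeatBound.inRange && C.negation.refutes known l
    · rw [hcond] at h
      exact absurd h Bool.false_ne_true
    rw [hcond] at h
    rw [Bool.and_eq_true] at hcond
    refine ih (List.forall_mem_cons.2 ⟨fun s' hs' => ?_, hknown⟩) h
    by_contra hC
    have := (SeatClause.sound_negation hs' hcond.1 hC).refutes_eq_false hs' hknown l
    rw [hcond.2] at this
    exact Bool.noConfusion this

/-- A refutation of the existence of a strategyproof and weakly representative rule for six voters,
four parties and three seats. -/
def seatRefutation : List (SeatClause × List PropagationStep) := [
   ([
      ⟨[1, 1, 1, 2, 5, 6], 6, 1⟩],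
    [
      .move 0 6 2]),
   ([
      ⟨[1, 1, 1, 2, 10, 13], 10, 1⟩],
    [
      .move 0 10 2]),
   ([
      ⟨[1, 2, 2, 3, 4, 4], 3, 2⟩],
    [
      .move 0 3 1]),
   ([
      ⟨[1, 1, 2, 4, 5, 10], 10, 1⟩],
    [
      .move 0 10 2]),
   ([
      ⟨[1, 1, 2, 4, 9, 10], 10, 1⟩],
    [
      .move 0 10 2]),
   ([
      ⟨[1, 1, 2, 4, 6, 9], 6, 1⟩],
    [
      .move 0 6 2]),
   ([
      ⟨[1, 1, 2, 4, 10, 12], 10, 1⟩],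
    [
      .move 0 10 2]),
   ([
      ⟨[1, 2, 2, 3, 4, 13], 3, 2⟩],
    [
      .move 0 3 1]),
   ([
      ⟨[1, 1, 2, 5, 9, 10], 10, 1⟩],
    [
      .move 0 10 2]),
   ([
      ⟨[1, 1, 2, 5, 11, 14], 14, 1⟩],
    [
      .move 0 14 2]),
   ([
      ⟨[1, 1, 2, 5, 10, 12], 10, 1⟩],
    [
      .move 0 10 2]),
   ([
      ⟨[1, 1, 2, 5, 10, 13], 10, 1⟩],
    [
      .move 0 10 2]),
   ([
      ⟨[1, 1, 2, 5, 10, 14], 10, 1⟩],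
    [
      .move 0 10 2]),
   ([
      ⟨[1, 2, 3, 4, 6, 9], 9, 1⟩],
    [
      .move 0 9 1]),
   ([
      ⟨[1, 2, 3, 5, 6, 10], 5, 1⟩],
    [
      .move 0 5 1]),
   ([
      ⟨[1, 2, 4, 6, 8, 9], 9, 1⟩],
    [
      .move 0 9 1]),
   ([
      ⟨[1, 2, 4, 6, 9, 10], 9, 1⟩],
    [
      .move 0 9 1]),
   ([
      ⟨[1, 2, 4, 6, 9, 14], 9, 1⟩],
    [
      .move 0 9 1]),
   ([
      ⟨[1, 2, 4, 7, 9, 10], 9, 1⟩],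
    [
      .move 0 9 1]),
   ([
      ⟨[1, 2, 4, 5, 10, 10], 5, 1⟩],
    [
      .move 0 5 1]),
   ([
      ⟨[1, 2, 4, 9, 10, 14], 9, 1⟩],
    [
      .move 0 9 1]),
   ([
      ⟨[1, 2, 6, 6, 9, 10], 9, 1⟩],
    [
      .move 0 9 1]),
   ([
      ⟨[1, 2, 6, 6, 9, 14], 9, 1⟩],
    [
      .move 0 9 1]),
   ([
      ⟨[1, 2, 6, 9, 12, 14], 9, 1⟩],
    [
      .move 0 9 1]),
   ([
      ⟨[1, 1, 2, 4, 5, 10], 11, 2⟩],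
    [
      .cite 20 1 2 4 8]),
   ([
      ⟨[1, 2, 4, 5, 10, 11], 11, 2⟩],
    [
      .cite 0 1 2 4 8, .move 0 11 1]),
   ([
      ⟨[2, 4, 5, 7, 8, 13], 10, 1⟩, ⟨[2, 4, 5, 5, 8, 10], 10, 2⟩],
    [
      .cite 3 8 4 1 2, .move 1 7 5, .move 1 13 5, .move 3 8 10, .cite 3 2 4 1 8, .move 5 13 8,
      .move 0 2 7, .move 4 2 10]),
   ([
      ⟨[2, 2, 4, 7, 8, 10], 13, 1⟩, ⟨[2, 2, 2, 4, 8, 12], 13, 2⟩],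
    [
      .cite 25 2 8 1 4, .move 1 10 2, .move 3 4 12, .move 2 7 4, .cite 26 2 4 8 1, .move 1 7 2,
      .move 0 8 10, .move 5 8 12]),
   ([
      ⟨[1, 4, 6, 8, 9, 14], 7, 2⟩, ⟨[1, 4, 7, 8, 8, 14], 1, 1⟩],
    [
      .cite 24 8 4 1 2, .move 1 14 8, .move 2 6 14, .move 1 9 8, .move 4 6 7, .move 0 7 5,
      .move 0 7 1, .move 5 14 8, .cite 0 2 8 4 1, .move 6 1 9]),
   ([
      ⟨[1, 3, 4, 8, 11, 12], 7, 2⟩, ⟨[1, 3, 7, 8, 8, 12], 8, 2⟩],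
    [
      .cite 0 4 2 1 8, .cite 25 8 1 4 2, .move 1 11 8, .move 2 11 3, .move 3 4 7, .move 4 4 12]),
   ([
      ⟨[1, 2, 4, 6, 8, 9], 8, 1⟩, ⟨[1, 2, 4, 7, 8, 12], 13, 3⟩, ⟨[1, 2, 4, 7, 8, 9], 13, 3⟩,
      ⟨[1, 2, 4, 7, 8, 9], 3, 3⟩, ⟨[1, 2, 2, 4, 7, 8], 3, 3⟩, ⟨[1, 2, 2, 4, 7, 8], 8, 1⟩,
      ⟨[1, 2, 4, 7, 8, 12], 8, 1⟩],
    [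
      .move 3 1 7, .move 3 6 7, .cite 12 8 2 4 1, .move 2 9 8, .move 4 9 1, .move 6 6 2,
      .move 1 2 8, .move 6 6 12, .move 0 12 8]),
   ([
      ⟨[1, 3, 4, 6, 8, 9], 1, 2⟩, ⟨[1, 3, 4, 6, 8, 9], 11, 3⟩, ⟨[1, 2, 4, 6, 8, 9], 11, 3⟩,
      ⟨[1, 4, 6, 8, 9, 14], 8, 2⟩, ⟨[1, 3, 4, 6, 8, 9], 12, 2⟩, ⟨[1, 2, 4, 6, 8, 9], 7, 3⟩],
    [
      .move 1 3 6, .cite 4 2 1 4 8, .move 1 3 2, .move 1 3 7, .move 0 2 14, .move 2 9 1,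
      .move 6 6 7, .move 6 1 7, .cite 2 8 2 4 1, .move 4 14 8, .move 5 9 8]),
   ([
      ⟨[1, 2, 4, 6, 9, 13], 6, 2⟩, ⟨[1, 2, 4, 9, 11, 13], 2, 1⟩],
    [
      .move 1 13 9, .move 1 6 2, .move 3 2 11, .cite 5 8 2 1 4]),
   ([
      ⟨[1, 1, 4, 6, 9, 14], 14, 2⟩, ⟨[1, 2, 4, 6, 9, 9], 11, 3⟩, ⟨[1, 2, 4, 6, 9, 13], 9, 2⟩],
    [
      .move 2 14 2, .move 2 14 4, .move 3 1 9, .move 4 1 11, .cite 3 1 8 2 4, .move 0 13 9]),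
   ([
      ⟨[1, 2, 4, 8, 13, 14], 14, 3⟩, ⟨[1, 4, 7, 8, 10, 12], 8, 2⟩, ⟨[1, 4, 7, 8, 10, 12], 3, 2⟩,
      ⟨[1, 4, 6, 8, 10, 12], 3, 1⟩, ⟨[1, 2, 4, 6, 8, 13], 5, 3⟩, ⟨[1, 2, 4, 6, 8, 12], 7, 3⟩,
      ⟨[1, 2, 4, 7, 8, 13], 9, 2⟩, ⟨[1, 2, 4, 7, 8, 13], 5, 3⟩, ⟨[1, 2, 4, 7, 8, 12], 6, 3⟩,
      ⟨[1, 2, 4, 7, 8, 12], 3, 2⟩, ⟨[1, 2, 4, 6, 8, 13], 9, 2⟩],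
    [
      .move 6 14 7, .move 6 14 6, .move 2 13 12, .move 0 13 12, .move 1 2 10, .move 3 2 10,
      .move 4 6 7]),
   ([
      ⟨[1, 3, 7, 8, 8, 12], 8, 2⟩, ⟨[1, 3, 7, 8, 8, 12], 4, 1⟩, ⟨[1, 3, 4, 8, 11, 12], 4, 1⟩],
    [
      .move 1 12 4, .move 2 8 11, .cite 2 1 4 8 2, .cite 5 1 2 4 8]),
   ([
      ⟨[4, 5, 7, 8, 8, 10], 8, 2⟩, ⟨[1, 2, 4, 5, 8, 10], 11, 3⟩, ⟨[1, 2, 4, 5, 8, 10], 13, 3⟩,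
      ⟨[2, 4, 5, 8, 9, 10], 6, 2⟩, ⟨[2, 4, 5, 8, 9, 10], 11, 3⟩],
    [
      .cite 32 8 4 2 1, .cite 6 4 1 2 8, .move 0 9 13, .cite 3 4 2 8 1, .move 4 10 2,
      .move 5 13 8, .move 6 5 7, .move 7 2 10, .cite 7 8 1 4 2, .cite 4 8 1 4 2, .move 2 7 2,
      .move 3 8 9]),
   ([
      ⟨[1, 2, 3, 4, 9, 12], 6, 2⟩, ⟨[1, 3, 4, 5, 8, 12], 3, 2⟩, ⟨[1, 3, 4, 5, 10, 12], 8, 1⟩,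
      ⟨[1, 2, 3, 4, 9, 12], 8, 1⟩],
    [
      .cite 33 1 4 2 8, .cite 20 4 1 2 8, .move 0 9 5, .cite 33 4 1 8 2, .move 0 9 1,
      .move 0 9 13, .move 3 2 14, .cite 1 4 8 2 1, .move 4 2 10, .move 7 14 4, .move 8 1 11,
      .move 1 10 8, .move 2 5 4, .move 2 5 7, .move 5 8 11, .cite 1 1 2 8 4]),
   ([
      ⟨[3, 4, 5, 8, 10, 12], 6, 1⟩, ⟨[3, 4, 5, 8, 9, 12], 1, 2⟩, ⟨[4, 4, 5, 8, 9, 10], 6, 2⟩,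
      ⟨[3, 4, 5, 8, 9, 10], 6, 1⟩, ⟨[1, 4, 5, 8, 9, 10], 6, 1⟩],
    [
      .move 4 3 9, .move 4 10 9, .cite 23 4 8 1 2, .move 5 12 4, .move 3 12 10, .move 2 5 1,
      .move 1 3 1, .move 6 4 5]),
   ([
      ⟨[1, 2, 4, 8, 12, 13], 3, 1⟩, ⟨[2, 3, 4, 5, 8, 12], 10, 2⟩, ⟨[1, 2, 3, 4, 8, 12], 13, 3⟩,
      ⟨[1, 2, 3, 4, 8, 12], 7, 3⟩],
    [
      .cite 16 2 4 8 1, .move 2 1 3, .move 2 8 12, .move 5 1 3, .move 3 13 1, .move 2 8 14,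
      .cite 21 2 4 8 1, .move 4 13 5, .cite 6 4 1 2 8, .cite 5 4 1 2 8, .cite 2 1 8 2 4]),
   ([
      ⟨[2, 3, 4, 7, 8, 12], 12, 2⟩, ⟨[2, 3, 4, 8, 11, 12], 4, 1⟩],
    [
      .move 1 12 11, .move 1 12 8, .move 3 3 11, .cite 7 2 8 4 1, .cite 11 4 1 2 8,
      .cite 7 2 4 8 1]),
   ([
      ⟨[1, 4, 6, 8, 9, 14], 9, 2⟩, ⟨[1, 4, 6, 7, 8, 9], 8, 1⟩],
    [
      .move 1 9 7, .move 1 9 1, .cite 8 4 1 8 2, .move 3 6 7, .cite 8 4 8 1 2, .cite 12 8 2 4 1]),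
   ([
      ⟨[1, 2, 4, 6, 8, 11], 12, 1⟩, ⟨[1, 2, 3, 6, 8, 12], 2, 2⟩, ⟨[1, 2, 3, 4, 8, 12], 13, 3⟩],
    [
      .move 2 11 3, .move 2 6 3, .move 4 8 12, .cite 24 4 1 2 8, .move 3 4 12, .move 5 11 8,
      .move 1 6 4]),
   ([
      ⟨[1, 3, 4, 6, 8, 12], 5, 2⟩, ⟨[1, 3, 4, 6, 8, 10], 9, 2⟩, ⟨[1, 4, 6, 8, 10, 12], 9, 2⟩,
      ⟨[1, 4, 5, 6, 8, 10], 9, 2⟩, ⟨[1, 4, 6, 7, 8, 10], 6, 3⟩, ⟨[1, 3, 4, 6, 8, 10], 2, 2⟩],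
    [
      .move 4 3 10, .move 3 12 5, .cite 22 8 4 1 2, .move 4 12 10, .move 0 3 1, .cite 36 1 4 8 2,
      .move 0 3 7, .move 1 7 5, .move 5 1 5]),
   ([
      ⟨[1, 3, 4, 6, 8, 10], 9, 2⟩, ⟨[1, 4, 5, 8, 10, 11], 1, 2⟩, ⟨[1, 5, 6, 8, 8, 10], 3, 2⟩,
      ⟨[1, 4, 6, 8, 8, 10], 12, 3⟩, ⟨[1, 4, 5, 6, 8, 10], 9, 2⟩, ⟨[1, 4, 6, 8, 10, 12], 3, 2⟩,
      ⟨[1, 3, 4, 6, 8, 12], 5, 2⟩, ⟨[1, 3, 4, 6, 8, 10], 2, 2⟩, ⟨[1, 4, 6, 8, 9, 14], 6, 2⟩,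
      ⟨[1, 4, 6, 6, 8, 9], 9, 2⟩],
    [
      .cite 37 1 8 4 2, .cite 33 8 1 2 4, .move 3 12 10, .move 2 3 1, .cite 21 8 4 2 1,
      .move 9 1 9, .move 3 3 10, .cite 27 8 4 1 2, .move 2 3 9, .move 2 3 5, .move 5 6 14,
      .cite 3 2 8 1 4, .move 8 11 8, .move 13 4 6, .move 7 5 4, .move 6 8 9, .move 6 8 12,
      .move 11 10 14, .cite 0 1 2 4 8, .move 1 14 6, .move 14 10 6, .move 0 1 7, .move 15 1 9]),
   ([
      ⟨[1, 2, 4, 5, 8, 10], 1, 1⟩, ⟨[1, 2, 3, 4, 8, 14], 6, 3⟩, ⟨[1, 2, 4, 7, 8, 14], 6, 3⟩,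
      ⟨[1, 2, 4, 8, 8, 14], 1, 1⟩, ⟨[1, 2, 4, 8, 8, 14], 12, 3⟩, ⟨[1, 2, 4, 5, 8, 14], 12, 3⟩,
      ⟨[1, 2, 3, 4, 8, 14], 1, 1⟩],
    [
      .cite 14 4 8 2 1, .move 4 10 14, .move 4 4 14, .cite 27 1 2 8 4, .move 5 5 4, .move 1 5 7,
      .move 6 10 3, .move 0 3 7]),
   ([
      ⟨[1, 3, 7, 8, 8, 12], 7, 2⟩, ⟨[1, 3, 4, 6, 8, 10], 9, 2⟩, ⟨[1, 4, 5, 6, 8, 10], 9, 2⟩,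
      ⟨[1, 4, 6, 8, 10, 12], 3, 2⟩, ⟨[1, 3, 4, 6, 8, 12], 5, 2⟩, ⟨[1, 3, 4, 6, 8, 10], 2, 2⟩,
      ⟨[1, 4, 6, 8, 9, 14], 6, 2⟩, ⟨[1, 4, 6, 6, 8, 9], 9, 2⟩, ⟨[1, 3, 6, 8, 10, 12], 2, 2⟩,
      ⟨[1, 2, 3, 8, 10, 12], 2, 2⟩, ⟨[1, 2, 3, 8, 8, 12], 13, 3⟩],
    [
      .cite 37 8 1 4 2, .move 9 7 1, .move 0 2 6, .move 9 7 2, .cite 35 8 1 4 2, .move 11 8 10,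
      .move 9 7 6, .move 0 2 10, .move 12 3 10, .move 12 8 10, .move 0 8 10, .move 10 3 6,
      .move 1 3 1, .move 14 12 4, .move 2 12 8, .move 17 3 5, .cite 1 1 2 4 8, .move 15 2 3,
      .cite 16 8 2 4 1, .move 20 14 12, .move 13 3 5]),
   ([
      ⟨[1, 2, 3, 5, 8, 12], 10, 2⟩, ⟨[1, 2, 4, 5, 8, 11], 4, 1⟩, ⟨[1, 2, 4, 5, 8, 11], 10, 2⟩,
      ⟨[1, 2, 3, 5, 6, 8], 10, 2⟩, ⟨[1, 2, 5, 6, 8, 9], 10, 2⟩, ⟨[1, 2, 3, 5, 8, 12], 13, 3⟩],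
    [
      .cite 30 8 1 2 4, .move 0 12 6, .move 2 3 9, .cite 30 2 1 8 4, .move 1 6 4, .move 0 12 4,
      .move 4 9 11, .move 5 3 11]),
   ([
      ⟨[1, 2, 4, 6, 8, 9], 4, 1⟩, ⟨[1, 2, 3, 4, 6, 9], 9, 2⟩, ⟨[1, 2, 5, 6, 8, 9], 10, 2⟩,
      ⟨[1, 2, 4, 6, 8, 9], 3, 3⟩, ⟨[1, 2, 4, 6, 8, 9], 13, 3⟩],
    [
      .move 0 4 5, .move 0 8 11, .cite 31 2 1 8 4, .cite 11 4 8 2 1, .cite 10 1 8 2 4,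
      .move 4 14 2, .move 6 1 13, .move 5 12 4, .cite 18 1 8 4 2, .move 2 3 1, .move 4 14 4,
      .move 8 1 13, .cite 7 8 1 2 4]),
   ([
      ⟨[1, 1, 2, 6, 9, 14], 14, 2⟩, ⟨[1, 2, 5, 6, 9, 12], 6, 2⟩, ⟨[1, 1, 2, 6, 9, 12], 3, 3⟩,
      ⟨[1, 1, 2, 4, 5, 8], 14, 2⟩, ⟨[1, 1, 2, 5, 10, 12], 3, 3⟩],
    [
      .cite 45 1 2 4 8, .cite 40 1 2 8 4, .move 4 14 4, .cite 38 1 2 8 4, .move 4 14 12,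
      .move 2 6 5, .cite 38 1 2 4 8, .move 2 12 5, .move 2 12 4, .move 6 6 4, .move 2 1 5,
      .move 3 9 1, .move 9 9 8, .move 6 6 12, .move 7 9 5, .move 10 12 4, .move 1 8 10,
      .move 11 6 10, .move 5 1 11, .move 8 9 10, .move 0 12 14, .move 5 4 14, .cite 13 2 8 4 1]),
   ([
      ⟨[1, 2, 5, 8, 10, 12], 12, 2⟩, ⟨[1, 2, 5, 8, 9, 10], 5, 2⟩, ⟨[1, 2, 4, 5, 8, 10], 2, 1⟩],
    [
      .cite 34 2 1 4 8, .move 2 12 9, .move 2 12 4, .move 1 9 4]),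
   ([
      ⟨[1, 2, 6, 8, 9, 12], 12, 2⟩, ⟨[1, 2, 3, 6, 8, 12], 10, 3⟩, ⟨[2, 3, 6, 7, 8, 9], 12, 2⟩,
      ⟨[2, 4, 6, 8, 9, 11], 4, 1⟩, ⟨[1, 2, 6, 6, 8, 9], 5, 2⟩, ⟨[1, 2, 3, 6, 8, 12], 9, 2⟩,
      ⟨[1, 2, 3, 7, 8, 12], 5, 2⟩, ⟨[1, 2, 3, 6, 8, 12], 5, 2⟩],
    [
      .cite 39 2 8 4 1, .move 5 1 3, .move 6 2 3, .cite 34 8 2 1 4, .move 0 1 9,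
      .cite 31 1 2 8 4, .cite 29 8 2 4 1, .move 5 9 3, .cite 33 8 1 2 4, .move 7 3 2,
      .move 0 12 6, .move 10 1 9, .move 0 6 7, .move 1 12 6, .move 9 12 13, .move 1 3 6,
      .move 13 12 14, .move 8 3 1, .cite 18 2 1 8 4, .move 11 1 9, .cite 17 2 1 8 4,
      .cite 15 8 1 4 2, .move 4 3 2, .move 12 13 7]),
   ([
      ⟨[1, 3, 4, 8, 10, 12], 2, 1⟩, ⟨[1, 2, 6, 8, 9, 12], 3, 2⟩, ⟨[1, 2, 6, 8, 9, 14], 6, 2⟩,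
      ⟨[1, 3, 6, 8, 10, 12], 2, 2⟩, ⟨[1, 3, 4, 8, 11, 12], 4, 1⟩, ⟨[1, 2, 7, 8, 8, 10], 13, 3⟩,
      ⟨[1, 3, 6, 8, 9, 12], 9, 3⟩, ⟨[1, 2, 3, 8, 8, 12], 13, 3⟩, ⟨[1, 3, 4, 8, 10, 12], 5, 2⟩],
    [
      .move 0 10 8, .cite 48 8 1 4 2, .move 8 4 7, .cite 35 1 8 4 2, .cite 16 1 2 4 8,
      .move 0 10 9, .move 0 4 6, .move 9 7 2, .move 10 4 6, .move 2 3 2, .move 7 12 14,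
      .move 5 6 2, .cite 23 1 4 2 8, .move 1 8 10, .move 11 12 8, .move 12 14 10, .move 3 7 3]),
   ([
      ⟨[1, 3, 4, 8, 10, 12], 2, 1⟩, ⟨[1, 2, 7, 8, 8, 10], 13, 3⟩, ⟨[1, 3, 6, 8, 9, 12], 9, 3⟩,
      ⟨[1, 2, 3, 8, 8, 12], 13, 3⟩, ⟨[1, 2, 6, 8, 9, 14], 6, 2⟩, ⟨[1, 2, 6, 8, 9, 12], 3, 2⟩,
      ⟨[1, 3, 4, 8, 10, 12], 5, 2⟩, ⟨[1, 3, 6, 8, 10, 12], 2, 2⟩],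
    [
      .cite 36 1 8 4 2, .cite 0 1 2 4 8, .move 7 11 10]),
   ([
      ⟨[1, 2, 4, 8, 11, 12], 12, 2⟩, ⟨[1, 2, 3, 4, 8, 12], 11, 3⟩],
    [
      .move 1 11 3, .move 1 1 3, .move 0 1 7, .cite 13 1 2 8 4]),
   ([
      ⟨[1, 2, 4, 6, 9, 10], 5, 2⟩, ⟨[1, 2, 2, 6, 8, 9], 14, 3⟩, ⟨[1, 2, 3, 6, 8, 9], 2, 2⟩,
      ⟨[1, 2, 4, 6, 8, 9], 8, 1⟩, ⟨[1, 2, 4, 6, 8, 9], 11, 3⟩, ⟨[1, 2, 4, 6, 8, 9], 14, 3⟩],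
    [
      .move 0 8 10, .cite 6 2 1 8 4, .cite 38 1 2 4 8, .move 1 3 2, .cite 18 8 4 1 2,
      .move 4 13 8]),
   ([
      ⟨[1, 2, 4, 6, 8, 9], 13, 3⟩, ⟨[1, 2, 4, 7, 8, 10], 5, 2⟩, ⟨[1, 2, 3, 4, 8, 12], 11, 3⟩,
      ⟨[1, 2, 4, 7, 8, 12], 5, 3⟩, ⟨[1, 1, 2, 4, 7, 8], 5, 3⟩, ⟨[1, 2, 4, 7, 8, 10], 8, 1⟩,
      ⟨[1, 2, 3, 4, 8, 12], 13, 3⟩, ⟨[1, 2, 4, 6, 8, 9], 11, 3⟩, ⟨[1, 2, 4, 6, 8, 9], 14, 3⟩],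
    [
      .cite 38 8 2 4 1, .cite 52 2 4 1 8, .move 0 9 1, .cite 33 8 2 1 4, .move 7 6 7,
      .move 0 2 6, .cite 34 4 2 1 8, .move 0 1 7, .move 5 9 1, .cite 29 2 1 4 8, .move 11 6 10,
      .move 2 1 3, .move 12 6 2, .move 13 7 3, .move 13 10 3, .cite 13 1 2 8 4, .move 15 8 12,
      .move 16 4 12, .move 17 10 2, .cite 10 8 2 4 1, .move 6 1 13, .move 10 10 8, .move 8 7 4,
      .move 1 1 3, .move 1 8 14, .cite 20 4 8 1 2, .move 18 13 8, .move 19 3 2]),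
   ([
      ⟨[4, 5, 6, 8, 9, 10], 2, 1⟩, ⟨[2, 4, 4, 6, 8, 9], 1, 1⟩, ⟨[3, 4, 4, 6, 8, 12], 5, 3⟩,
      ⟨[3, 4, 4, 6, 8, 9], 5, 3⟩, ⟨[4, 5, 6, 8, 9, 10], 9, 2⟩, ⟨[3, 4, 4, 5, 8, 12], 1, 1⟩,
      ⟨[1, 4, 5, 6, 8, 10], 9, 2⟩, ⟨[1, 4, 6, 8, 9, 10], 11, 3⟩, ⟨[1, 2, 4, 6, 8, 13], 2, 1⟩,
      ⟨[2, 4, 6, 8, 9, 13], 2, 1⟩, ⟨[1, 3, 4, 6, 8, 9], 2, 1⟩, ⟨[1, 2, 4, 6, 8, 13], 9, 2⟩,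
      ⟨[1, 3, 4, 6, 8, 12], 9, 2⟩, ⟨[1, 2, 4, 6, 8, 9], 11, 3⟩, ⟨[1, 2, 4, 6, 8, 9], 14, 3⟩],
    [
      .cite 53 4 8 2 1, .cite 53 4 1 8 2, .move 8 5 4, .move 8 10 8, .move 14 5 7,
      .cite 40 4 1 8 2, .cite 27 4 2 1 8, .move 13 10 2, .cite 20 2 1 4 8, .move 5 10 12,
      .move 11 2 11, .cite 46 4 8 2 1, .move 11 9 12, .cite 21 8 1 2 4, .move 19 2 3,
      .move 10 6 5, .move 18 11 3, .move 9 3 1, .move 10 6 1, .move 20 4 14, .move 7 5 1,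
      .move 20 4 12, .cite 15 1 2 4 8, .move 17 9 10, .move 12 4 6, .move 21 7 3,
      .cite 9 4 8 2 1, .move 3 9 12]),
   ([
      ⟨[1, 2, 4, 6, 8, 13], 14, 3⟩, ⟨[1, 2, 4, 6, 8, 13], 9, 2⟩, ⟨[1, 2, 3, 4, 8, 12], 11, 3⟩,
      ⟨[2, 4, 5, 8, 10, 13], 5, 2⟩, ⟨[1, 2, 4, 7, 8, 10], 8, 1⟩, ⟨[1, 2, 5, 7, 8, 10], 8, 1⟩,
      ⟨[1, 4, 5, 7, 8, 10], 8, 1⟩, ⟨[1, 2, 3, 4, 8, 12], 13, 3⟩, ⟨[1, 2, 4, 6, 8, 9], 11, 3⟩,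
      ⟨[1, 2, 4, 6, 8, 9], 14, 3⟩],
    [
      .move 6 6 7, .cite 47 4 8 1 2, .move 1 2 6, .cite 41 8 2 4 1, .cite 45 2 1 8 4,
      .cite 48 2 1 8 4, .cite 41 4 8 1 2, .move 6 4 7, .cite 41 8 4 2 1, .cite 54 4 8 1 2,
      .cite 49 4 8 1 2, .cite 41 8 4 1 2, .move 0 1 5, .cite 40 8 1 4 2, .move 2 10 2,
      .move 19 5 13, .move 19 5 1, .move 7 13 8, .move 19 5 12, .move 21 8 10, .cite 1 1 2 4 8,
      .move 0 1 13, .move 0 2 10, .move 0 2 3, .move 0 9 13, .move 6 4 5, .move 6 13 4,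
      .move 25 6 7, .move 6 13 5, .cite 25 1 8 2 4, .move 28 2 10, .cite 29 8 4 1 2,
      .cite 28 1 4 8 2, .move 3 2 6, .move 11 5 7, .move 12 10 8, .move 29 2 6, .move 14 13 5,
      .move 31 2 10, .move 30 6 4, .move 2 7 6, .move 18 1 9, .move 18 6 14, .move 18 6 4,
      .move 16 1 11, .cite 22 8 2 1 4, .move 34 11 8, .move 16 10 12, .move 34 11 2,
      .move 35 4 7, .move 34 11 9, .move 34 11 3, .move 36 1 3, .move 39 4 6, .cite 28 4 1 2 8,
      .move 39 5 6, .move 5 13 4, .move 37 2 6, .move 17 10 2, .move 37 2 3, .move 42 5 1,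
      .move 8 10 6, .move 8 4 6, .move 17 10 3, .move 26 1 9, .move 43 5 12, .move 43 5 9,
      .cite 0 1 2 4 8, .move 32 5 4, .move 32 10 2, .move 41 10 3, .move 41 10 11, .move 15 5 3,
      .cite 8 4 8 2 1, .move 44 10 2, .cite 28 8 1 2 4, .move 49 5 9, .move 10 3 11,
      .cite 17 1 8 4 2]),
   ([
      ⟨[1, 2, 4, 6, 8, 13], 1, 1⟩, ⟨[1, 2, 4, 4, 6, 8], 11, 2⟩, ⟨[1, 2, 4, 6, 8, 9], 2, 1⟩,
      ⟨[1, 2, 3, 4, 8, 12], 11, 3⟩, ⟨[1, 2, 3, 4, 8, 12], 13, 3⟩, ⟨[1, 2, 4, 6, 8, 9], 11, 3⟩,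
      ⟨[1, 2, 4, 6, 8, 9], 12, 3⟩],
    [
      .move 0 2 3, .cite 54 4 8 1 2, .cite 48 4 1 2 8, .move 0 9 13, .cite 50 4 1 2 8,
      .cite 55 4 8 2 1, .cite 50 4 1 8 2, .move 3 1 9, .move 3 6 12, .cite 42 1 4 8 2,
      .cite 55 4 1 2 8, .move 0 8 13, .cite 55 4 1 8 2, .cite 48 4 1 8 2, .move 11 8 12,
      .cite 42 4 1 8 2, .move 0 1 13, .cite 36 2 4 8 1, .cite 16 8 4 2 1, .move 10 13 12,
      .cite 19 1 2 8 4, .move 20 3 6, .move 12 6 4, .move 17 1 3, .move 12 6 7, .move 19 12 4,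
      .move 12 8 9, .move 18 13 1, .move 8 2 11, .move 15 8 11, .cite 10 8 4 2 1,
      .cite 23 1 2 8 4, .move 26 10 14, .cite 23 8 1 2 4, .move 25 12 4, .move 28 11 1,
      .move 24 6 4, .move 25 11 10, .move 24 11 1, .move 25 11 2, .move 30 11 1, .move 25 11 1,
      .move 34 4 14, .move 33 9 1, .move 29 3 9, .move 32 4 12, .cite 29 4 8 2 1, .move 31 9 10,
      .move 36 8 9, .move 37 4 6, .move 39 4 14, .move 23 12 14, .cite 18 8 4 1 2, .move 38 13 4,
      .move 32 2 10, .move 16 3 6, .move 32 2 6, .move 9 3 10, .move 42 12 8, .move 9 1 9,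
      .move 42 12 9, .move 5 10 2, .move 2 8 9, .move 2 1 9, .move 8 8 12, .move 44 2 3,
      .move 43 3 1, .move 7 12 8, .move 7 12 10, .move 31 4 14, .cite 17 1 2 4 8, .move 45 7 2,
      .move 6 10 11, .cite 22 2 8 4 1, .cite 23 1 8 2 4, .move 4 8 12, .move 22 12 4,
      .move 47 3 2, .move 46 11 2]),
   ([
      ⟨[1, 2, 4, 5, 8, 10], 8, 1⟩, ⟨[1, 2, 4, 6, 8, 13], 14, 3⟩, ⟨[1, 2, 4, 6, 8, 13], 9, 2⟩,
      ⟨[1, 2, 3, 4, 8, 12], 11, 3⟩, ⟨[1, 2, 3, 4, 8, 12], 13, 3⟩, ⟨[1, 2, 4, 6, 8, 9], 11, 3⟩,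
      ⟨[1, 2, 4, 6, 8, 9], 14, 3⟩],
    [
      .move 3 1 7, .move 3 4 7, .move 3 5 7, .cite 19 1 4 8 2, .move 3 2 7, .cite 1 1 2 4 8]),
   ([
      ⟨[1, 2, 4, 6, 8, 9], 5, 3⟩, ⟨[1, 2, 3, 4, 8, 12], 1, 1⟩, ⟨[1, 2, 3, 4, 8, 10], 7, 3⟩,
      ⟨[1, 1, 2, 5, 10, 14], 1, 2⟩, ⟨[1, 4, 5, 6, 8, 10], 2, 1⟩, ⟨[1, 2, 4, 5, 8, 13], 10, 1⟩,
      ⟨[1, 2, 4, 4, 6, 8], 11, 2⟩, ⟨[1, 2, 4, 6, 8, 9], 2, 1⟩, ⟨[1, 2, 4, 5, 8, 10], 13, 3⟩,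
      ⟨[1, 2, 4, 5, 8, 10], 7, 3⟩, ⟨[1, 2, 4, 6, 8, 13], 8, 1⟩, ⟨[1, 2, 4, 6, 8, 9], 14, 3⟩,
      ⟨[1, 2, 4, 6, 8, 9], 11, 3⟩],
    [
      .move 8 8 14, .cite 57 4 1 2 8, .move 8 1 9, .cite 31 2 8 4 1, .cite 40 1 2 4 8,
      .cite 6 2 4 1 8, .cite 44 8 4 1 2, .move 1 8 9, .cite 44 1 2 4 8, .cite 40 2 4 1 8,
      .cite 44 2 8 4 1, .cite 37 4 2 8 1, .cite 43 1 4 8 2, .cite 53 2 1 4 8, .move 2 8 10,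
      .cite 43 2 1 8 4, .cite 43 2 1 4 8, .cite 1 8 2 4 1, .move 6 1 9, .move 2 8 11,
      .move 0 2 4, .cite 20 8 2 4 1, .cite 45 1 2 8 4, .move 0 8 13, .move 8 2 14, .move 2 5 4,
      .move 8 12 14, .move 0 4 13, .cite 20 8 4 1 2, .move 2 8 9, .move 4 8 10, .move 15 13 5,
      .move 2 2 11, .cite 21 8 2 4 1, .move 23 13 9, .move 19 3 2, .move 23 13 1, .move 34 12 10,
      .move 22 6 4, .move 30 1 11, .cite 28 2 4 1 8, .move 27 10 14, .cite 20 8 1 2 4,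
      .move 29 12 14, .cite 20 8 2 1 4, .cite 25 2 8 4 1, .move 26 10 3, .move 26 14 2,
      .move 34 12 4, .move 2 1 3, .move 38 11 8, .move 30 4 14, .move 6 14 4, .move 26 14 6,
      .move 38 11 3, .cite 20 2 8 4 1, .move 33 10 3, .move 35 2 6, .move 49 1 9, .move 18 5 1,
      .move 36 8 9, .move 40 9 1, .move 52 6 14, .move 34 12 9, .move 42 5 13, .move 35 1 9,
      .move 38 11 9, .move 24 5 4, .move 45 1 9, .move 6 5 4, .move 35 1 3, .move 13 14 6,
      .move 56 1 9, .move 30 5 6, .move 36 10 9, .move 35 10 6, .move 14 14 13, .move 46 10 8,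
      .move 30 5 13, .move 48 12 14, .move 58 1 9, .move 55 10 11, .move 41 14 2, .move 37 8 10,
      .cite 21 8 1 2 4, .move 14 14 10, .move 30 5 12, .move 48 12 4, .move 51 10 6,
      .move 31 5 4, .move 10 2 11, .cite 12 1 4 2 8, .move 13 14 12, .move 53 11 3,
      .move 59 13 8, .move 56 10 14, .move 61 6 3, .move 16 9 12, .cite 7 4 1 8 2, .move 61 6 4,
      .move 66 3 5, .move 44 5 1, .move 31 6 4, .cite 25 1 8 2 4, .move 7 8 9, .move 62 8 12,
      .move 63 2 6, .move 62 1 3, .move 63 9 13, .move 42 5 1, .move 7 1 9, .move 28 8 12,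
      .move 70 2 6, .move 72 10 12, .move 39 2 10, .move 69 9 3, .move 20 14 6, .move 64 5 12,
      .move 64 5 13, .cite 28 4 1 2 8, .move 77 2 10, .move 76 2 10, .move 74 4 5, .move 75 1 9,
      .move 11 3 6, .move 78 14 10, .cite 12 8 4 2 1, .move 47 14 6, .move 5 10 9, .move 68 5 4,
      .move 17 2 3, .move 84 12 4, .move 83 10 12, .move 5 8 9, .move 79 13 9, .move 50 5 4,
      .cite 11 4 1 8 2, .move 86 4 6, .move 88 4 3, .move 8 8 10, .cite 14 1 8 2 4,
      .move 16 10 11, .move 16 2 3, .move 73 10 2, .move 40 11 3]),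
   ([
      ⟨[1, 2, 4, 5, 8, 10], 14, 3⟩, ⟨[1, 2, 4, 5, 9, 10], 8, 1⟩, ⟨[1, 1, 2, 5, 10, 14], 1, 2⟩,
      ⟨[1, 2, 4, 5, 8, 10], 13, 3⟩, ⟨[1, 2, 4, 5, 8, 10], 7, 3⟩],
    [
      .move 0 8 9, .cite 58 1 2 4 8, .move 0 8 11, .move 2 9 1, .cite 26 2 8 4 1, .move 3 4 14]),
   ([
      ⟨[1, 2, 4, 5, 8, 10], 1, 1⟩, ⟨[1, 2, 4, 6, 8, 13], 10, 1⟩],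
    [
      .cite 40 2 4 1 8, .cite 59 4 8 1 2, .move 1 2 14, .cite 41 8 4 1 2, .move 0 1 5,
      .move 1 1 5, .cite 47 1 2 8 4, .move 6 6 5, .move 6 13 5, .move 8 8 10, .cite 20 1 4 2 8,
      .move 2 13 8, .move 10 6 4, .move 3 1 11, .move 9 2 10, .cite 27 8 2 1 4, .move 5 6 2,
      .move 7 5 13, .cite 29 4 2 8 1]),
   ([
      ⟨[1, 2, 3, 4, 8, 12], 1, 1⟩, ⟨[1, 3, 4, 4, 10, 12], 5, 3⟩, ⟨[1, 4, 4, 6, 9, 11], 11, 2⟩,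
      ⟨[1, 4, 5, 6, 9, 10], 1, 2⟩, ⟨[2, 4, 5, 6, 9, 10], 6, 3⟩, ⟨[1, 2, 4, 8, 9, 14], 10, 3⟩,
      ⟨[1, 2, 3, 4, 8, 14], 10, 3⟩, ⟨[1, 2, 3, 4, 13, 14], 2, 2⟩, ⟨[1, 2, 2, 4, 8, 11], 10, 3⟩,
      ⟨[1, 2, 4, 9, 10, 12], 3, 2⟩, ⟨[1, 2, 2, 4, 5, 10], 14, 3⟩, ⟨[1, 2, 4, 6, 8, 9], 5, 3⟩,
      ⟨[1, 2, 4, 9, 10, 13], 5, 2⟩, ⟨[1, 2, 4, 9, 10, 12], 5, 2⟩, ⟨[1, 2, 4, 6, 9, 10], 5, 2⟩,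
      ⟨[2, 3, 4, 5, 9, 10], 1, 2⟩, ⟨[1, 4, 5, 8, 10, 14], 10, 2⟩, ⟨[2, 3, 4, 5, 8, 10], 12, 2⟩,
      ⟨[1, 1, 2, 5, 10, 14], 1, 2⟩, ⟨[1, 4, 5, 6, 8, 10], 2, 1⟩, ⟨[1, 2, 4, 5, 8, 13], 10, 1⟩,
      ⟨[1, 2, 4, 4, 6, 8], 11, 2⟩, ⟨[1, 2, 4, 6, 8, 12], 3, 2⟩, ⟨[1, 2, 4, 6, 8, 9], 2, 1⟩,
      ⟨[1, 2, 4, 5, 8, 10], 13, 3⟩, ⟨[1, 2, 4, 5, 8, 10], 7, 3⟩, ⟨[1, 2, 4, 6, 8, 13], 8, 1⟩,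
      ⟨[1, 2, 4, 6, 8, 12], 9, 2⟩, ⟨[1, 2, 4, 6, 8, 9], 14, 3⟩, ⟨[1, 2, 4, 6, 8, 9], 11, 3⟩],
    [
      .cite 46 2 1 8 4, .cite 24 8 1 2 4, .cite 43 2 4 1 8, .cite 46 1 4 8 2, .move 0 4 13,
      .move 3 5 3, .move 3 5 4, .move 23 2 14, .move 23 8 14, .move 25 6 4, .move 23 12 14,
      .move 0 6 2, .cite 47 4 2 1 8, .cite 47 8 4 1 2, .move 24 6 4, .move 25 6 3, .move 23 1 3,
      .cite 2 1 2 4 8, .cite 23 8 4 1 2, .cite 9 1 4 8 2, .move 28 3 7, .move 36 12 14,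
      .move 3 2 10, .move 0 8 13, .cite 42 4 2 1 8, .move 29 10 14, .move 27 3 2, .move 28 8 12,
      .move 16 14 2, .move 32 9 11, .cite 37 2 1 8 4, .move 17 8 12, .cite 23 8 1 2 4,
      .move 41 12 4, .move 43 10 2, .cite 10 4 1 8 2, .cite 18 1 8 2 4, .move 8 5 1,
      .cite 31 4 1 2 8, .move 31 2 10, .move 46 14 10, .move 18 14 10, .move 28 1 3,
      .move 18 14 13, .move 47 4 5, .move 9 14 6, .move 34 8 10, .move 49 8 12, .move 13 13 8,
      .move 6 8 9, .move 40 10 8, .move 20 5 4, .move 48 8 12, .move 12 2 6, .cite 14 4 1 8 2,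
      .move 12 9 13, .move 52 4 3, .move 23 8 10, .move 52 4 6, .move 1 8 10, .move 26 1 3,
      .move 33 1 13, .cite 16 2 4 8 1, .move 11 10 11, .move 54 10 2, .cite 30 2 8 4 1,
      .move 44 6 2, .move 57 9 8, .move 15 1 3, .cite 31 2 8 4 1, .move 58 2 7]),
   ([
      ⟨[1, 2, 4, 7, 8, 10], 8, 1⟩, ⟨[1, 2, 3, 4, 8, 12], 8, 1⟩, ⟨[1, 2, 3, 4, 8, 12], 14, 3⟩,
      ⟨[1, 2, 3, 4, 5, 10], 1, 2⟩, ⟨[1, 2, 4, 6, 8, 9], 7, 3⟩, ⟨[1, 2, 4, 7, 8, 14], 6, 3⟩,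
      ⟨[1, 2, 4, 5, 10, 11], 4, 1⟩, ⟨[1, 2, 4, 5, 8, 10], 14, 3⟩, ⟨[1, 2, 4, 6, 8, 9], 2, 1⟩,
      ⟨[1, 2, 4, 8, 11, 14], 10, 3⟩, ⟨[1, 2, 4, 5, 8, 10], 7, 3⟩, ⟨[1, 2, 3, 4, 8, 12], 11, 3⟩,
      ⟨[1, 2, 4, 6, 8, 9], 11, 3⟩],
    [
      .cite 10 1 4 8 2, .cite 47 8 1 2 4, .move 1 4 7, .cite 10 4 8 1 2, .move 8 12 4,
      .move 10 3 10, .move 7 10 14, .move 5 7 3, .move 7 10 6, .move 9 3 11, .cite 25 1 8 2 4,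
      .move 3 14 4, .move 13 4 5, .move 12 9 12, .cite 4 8 4 1 2, .move 14 8 10,
      .cite 16 2 4 8 1, .move 4 11 3, .move 16 12 5]),
   ([
      ⟨[1, 4, 5, 8, 10, 14], 14, 3⟩, ⟨[1, 3, 4, 6, 8, 10], 2, 2⟩, ⟨[1, 2, 4, 6, 8, 10], 7, 3⟩,
      ⟨[1, 2, 3, 4, 10, 12], 8, 1⟩, ⟨[1, 3, 4, 7, 8, 12], 8, 1⟩, ⟨[1, 2, 3, 4, 8, 12], 14, 3⟩,
      ⟨[1, 3, 4, 4, 10, 12], 5, 3⟩, ⟨[1, 4, 4, 6, 9, 11], 11, 2⟩, ⟨[1, 3, 4, 6, 8, 12], 3, 2⟩,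
      ⟨[1, 4, 5, 6, 8, 9], 3, 2⟩, ⟨[1, 2, 2, 4, 8, 11], 4, 1⟩, ⟨[1, 2, 5, 6, 9, 10], 1, 2⟩,
      ⟨[1, 4, 5, 6, 9, 10], 1, 2⟩, ⟨[1, 2, 4, 5, 8, 10], 4, 1⟩, ⟨[1, 2, 4, 5, 8, 10], 14, 3⟩,
      ⟨[1, 2, 5, 5, 8, 10], 13, 3⟩, ⟨[1, 2, 5, 7, 8, 10], 5, 2⟩, ⟨[1, 4, 5, 6, 8, 10], 2, 1⟩,
      ⟨[1, 2, 5, 5, 6, 8], 10, 1⟩, ⟨[1, 2, 4, 6, 8, 12], 3, 2⟩, ⟨[1, 2, 4, 6, 8, 9], 2, 1⟩,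
      ⟨[1, 4, 5, 8, 10, 10], 5, 2⟩, ⟨[1, 2, 4, 5, 8, 10], 7, 3⟩, ⟨[1, 3, 4, 6, 8, 12], 9, 2⟩,
      ⟨[1, 2, 3, 4, 8, 12], 11, 3⟩, ⟨[1, 2, 5, 6, 8, 9], 10, 2⟩, ⟨[1, 2, 4, 8, 9, 14], 6, 2⟩,
      ⟨[1, 2, 4, 6, 8, 11], 9, 2⟩],
    [
      .cite 11 2 8 1 4, .move 3 4 5, .move 5 1 11, .cite 62 4 1 8 2, .move 7 2 6,
      .cite 44 1 4 2 8, .cite 49 8 4 1 2, .cite 32 1 8 2 4, .cite 55 4 1 8 2, .cite 49 1 8 4 2,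
      .cite 43 4 8 2 1, .cite 55 4 1 2 8, .cite 57 4 1 2 8, .cite 36 2 8 4 1, .cite 11 1 2 4 8,
      .cite 60 4 1 8 2, .move 23 14 6, .move 17 11 8, .move 37 4 6, .cite 49 2 1 8 4,
      .move 5 8 11, .move 17 11 10, .cite 49 4 2 1 8, .move 23 14 10, .cite 48 4 2 8 1,
      .move 10 8 9, .move 5 10 11, .move 24 4 5, .move 10 10 9, .move 13 5 4, .cite 33 2 4 1 8,
      .move 16 5 4, .move 33 9 12, .move 6 1 11, .move 26 5 1, .move 16 5 6, .move 33 4 12,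
      .move 33 10 12, .move 42 10 12, .move 40 11 8, .move 32 5 1, .move 42 10 2, .move 44 10 9,
      .move 28 8 12, .move 37 4 12, .move 34 9 10, .move 41 6 3, .move 29 9 8, .move 47 6 2,
      .move 45 10 6, .move 18 10 11, .cite 36 1 2 8 4, .cite 25 2 1 4 8, .cite 30 1 2 8 4,
      .move 50 11 10, .move 49 11 8, .cite 33 1 8 4 2, .move 27 4 6, .move 4 3 11, .move 4 3 2,
      .move 8 4 5, .move 51 7 2, .move 8 8 10, .move 4 6 10, .cite 26 2 1 8 4, .move 4 12 10,
      .move 54 3 5, .move 4 3 10, .move 56 12 9, .move 54 3 2, .move 15 2 6, .cite 5 8 4 1 2,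
      .move 31 3 6, .move 1 14 12, .move 0 11 10, .move 38 5 6, .cite 22 1 2 8 4, .move 21 8 12,
      .move 57 8 9, .move 0 4 12, .move 59 10 12, .cite 16 4 1 8 2, .move 55 6 3, .move 20 12 5,
      .move 61 4 5, .move 46 9 11, .move 63 4 5, .cite 17 2 1 4 8, .move 52 6 2, .move 36 4 6,
      .move 65 8 9, .move 36 11 9, .move 58 4 5, .move 65 6 7, .move 11 7 5, .move 60 11 1,
      .move 14 10 8, .move 67 1 5, .move 12 10 14, .cite 22 2 4 1 8, .move 68 7 5, .move 64 12 6,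
      .move 64 12 14, .move 9 6 14]),
   ([
      ⟨[1, 2, 4, 6, 8, 9], 2, 1⟩, ⟨[1, 2, 4, 5, 8, 10], 13, 3⟩, ⟨[1, 2, 4, 6, 8, 13], 9, 2⟩,
      ⟨[1, 2, 4, 6, 8, 13], 14, 3⟩, ⟨[1, 2, 3, 4, 8, 12], 11, 3⟩, ⟨[1, 2, 4, 6, 8, 9], 14, 3⟩,
      ⟨[1, 2, 4, 6, 8, 9], 11, 3⟩, ⟨[1, 2, 3, 4, 8, 12], 13, 3⟩],
    [
      .cite 44 2 1 4 8, .cite 63 4 1 2 8, .move 2 8 9, .move 1 9 13, .cite 12 2 4 1 8,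
      .cite 60 4 1 2 8, .move 0 2 6, .move 2 13 4, .cite 49 4 2 8 1, .move 1 2 3, .move 1 4 5,
      .move 2 13 12, .cite 3 1 2 4 8, .cite 12 1 8 4 2, .move 0 3 6, .cite 49 2 1 4 8,
      .move 1 8 13, .move 2 13 5, .move 2 6 5, .cite 6 1 2 4 8, .move 2 4 5, .move 3 8 11,
      .move 17 2 10, .move 18 8 10, .move 3 2 10, .move 3 2 11, .cite 26 2 8 4 1, .move 19 6 7,
      .move 3 10 11, .cite 40 2 1 8 4, .move 6 13 5, .move 16 13 9, .move 3 1 3, .move 19 13 5,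
      .move 16 13 1, .move 3 1 11, .cite 26 8 2 4 1, .cite 34 1 8 2 4, .move 33 10 3,
      .move 28 2 10, .cite 27 8 2 4 1, .move 27 10 2, .move 19 6 5, .move 35 5 13, .move 37 10 3,
      .move 11 5 1, .move 39 8 10, .move 41 12 4, .move 42 10 2, .move 4 13 8, .cite 33 1 8 2 4,
      .cite 31 2 8 4 1, .cite 37 2 8 4 1, .move 46 14 4, .cite 34 2 4 1 8, .move 32 10 6,
      .cite 4 1 2 4 8, .move 47 11 8, .move 29 5 13, .move 29 5 12, .move 47 11 3,
      .cite 26 8 2 1 4, .move 32 2 6, .move 32 4 6, .move 29 10 8, .move 32 1 3, .move 29 5 6,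
      .move 33 14 2, .move 29 1 3, .move 55 5 6, .move 29 5 4, .move 48 1 9, .cite 27 8 1 2 4,
      .move 54 1 9, .move 53 1 9, .move 49 10 9, .move 60 6 3, .move 8 4 12, .move 60 6 7,
      .move 33 14 6, .move 52 10 8, .move 28 5 4, .move 64 1 9, .move 28 6 4, .move 1 6 2,
      .cite 29 1 8 4 2, .move 67 9 11, .move 66 9 3, .move 5 2 11, .move 43 5 12,
      .cite 31 1 8 2 4, .move 12 3 5, .move 69 2 10, .move 12 9 12, .cite 2 1 2 4 8,
      .cite 1 1 2 4 8, .move 0 8 10, .cite 12 4 8 1 2, .move 0 2 7, .move 62 14 10, .move 72 7 6,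
      .move 72 7 3, .move 75 2 6, .cite 0 1 2 4 8, .cite 26 2 8 1 4, .move 23 10 2,
      .move 26 11 1, .cite 7 2 4 1 8, .cite 6 2 4 1 8]),
   ([
      ⟨[1, 2, 4, 5, 8, 10], 14, 3⟩, ⟨[1, 2, 3, 4, 8, 14], 12, 2⟩, ⟨[1, 2, 3, 4, 8, 12], 8, 1⟩,
      ⟨[1, 2, 4, 6, 8, 9], 8, 1⟩, ⟨[1, 2, 4, 5, 8, 10], 13, 3⟩, ⟨[1, 2, 4, 5, 8, 10], 7, 3⟩,
      ⟨[1, 2, 3, 4, 8, 12], 11, 3⟩, ⟨[1, 2, 4, 6, 8, 9], 14, 3⟩, ⟨[1, 2, 4, 6, 8, 9], 11, 3⟩,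
      ⟨[1, 2, 3, 4, 8, 12], 13, 3⟩],
    [
      .move 2 2 10, .cite 7 4 1 2 8, .move 2 10 11, .move 3 3 11, .cite 41 2 1 8 4, .move 7 10 2,
      .move 6 14 4, .move 8 4 5, .move 5 11 1, .cite 7 2 4 1 8, .cite 8 2 4 1 8]),
   ([
      ⟨[1, 2, 3, 4, 8, 12], 14, 3⟩, ⟨[1, 2, 4, 6, 8, 9], 13, 3⟩, ⟨[1, 2, 4, 5, 8, 10], 13, 3⟩,
      ⟨[1, 2, 4, 5, 8, 10], 7, 3⟩, ⟨[1, 2, 3, 4, 8, 12], 11, 3⟩, ⟨[1, 2, 4, 6, 8, 9], 14, 3⟩,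
      ⟨[1, 2, 4, 6, 8, 9], 11, 3⟩, ⟨[1, 2, 3, 4, 8, 12], 13, 3⟩],
    [
      .cite 53 1 2 8 4, .cite 14 1 8 4 2, .cite 14 4 8 1 2, .cite 0 1 2 4 8, .move 2 2 10,
      .move 2 10 14, .cite 8 1 4 2 8, .move 3 6 14, .cite 42 2 1 8 4, .move 8 10 2, .move 7 11 1,
      .move 9 1 5, .cite 8 2 1 4 8, .cite 9 2 1 4 8, .move 6 14 4]),
   ([
      ⟨[1, 2, 4, 5, 8, 10], 1, 1⟩, ⟨[1, 2, 4, 8, 8, 14], 1, 1⟩, ⟨[1, 2, 4, 7, 8, 14], 6, 3⟩,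
      ⟨[1, 2, 3, 4, 8, 12], 1, 1⟩, ⟨[1, 2, 4, 5, 8, 10], 6, 3⟩, ⟨[1, 2, 4, 6, 8, 9], 14, 3⟩,
      ⟨[1, 2, 4, 6, 8, 9], 11, 3⟩],
    [
      .cite 54 1 2 8 4, .move 1 10 14, .move 1 4 14, .cite 52 1 2 8 4, .move 0 9 5, .move 6 5 4,
      .move 8 10 8, .move 8 10 3, .cite 24 1 4 2 8, .cite 10 8 1 4 2, .move 10 4 6, .move 5 14 6]),
   ([
      ⟨[1, 2, 3, 4, 8, 12], 8, 1⟩, ⟨[1, 2, 4, 7, 8, 12], 3, 2⟩, ⟨[1, 2, 3, 4, 8, 12], 3, 2⟩,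
      ⟨[1, 2, 4, 5, 8, 10], 14, 3⟩, ⟨[1, 2, 3, 4, 8, 12], 1, 1⟩, ⟨[1, 2, 4, 6, 8, 9], 8, 1⟩,
      ⟨[1, 2, 4, 6, 8, 9], 5, 3⟩, ⟨[1, 2, 4, 5, 8, 10], 7, 3⟩, ⟨[1, 2, 4, 6, 8, 9], 14, 3⟩],
    [
      .cite 53 8 2 4 1, .move 2 3 7, .move 0 1 7, .move 2 8 6, .move 2 1 5, .move 5 1 9,
      .move 4 9 1, .cite 33 4 8 2 1, .move 8 6 12, .move 5 3 9, .cite 22 4 1 8 2, .move 3 12 5,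
      .move 10 9 10, .cite 31 2 8 4 1]),
   ([
      ⟨[2, 3, 4, 6, 8, 9], 5, 2⟩, ⟨[1, 2, 4, 8, 8, 10], 13, 3⟩, ⟨[2, 3, 4, 6, 8, 9], 9, 2⟩,
      ⟨[3, 4, 5, 8, 10, 12], 5, 2⟩, ⟨[4, 4, 5, 8, 9, 10], 6, 2⟩, ⟨[3, 4, 6, 8, 9, 10], 1, 1⟩,
      ⟨[3, 4, 5, 8, 9, 12], 1, 2⟩, ⟨[2, 4, 7, 8, 9, 10], 1, 1⟩, ⟨[1, 2, 2, 6, 8, 9], 14, 3⟩,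
      ⟨[3, 4, 5, 8, 10, 12], 12, 3⟩, ⟨[1, 4, 5, 8, 8, 10], 14, 3⟩, ⟨[2, 4, 6, 8, 9, 11], 1, 1⟩,
      ⟨[2, 3, 4, 6, 8, 11], 1, 1⟩, ⟨[2, 3, 4, 5, 8, 10], 12, 2⟩, ⟨[1, 2, 3, 4, 8, 10], 7, 3⟩,
      ⟨[2, 3, 4, 6, 8, 9], 12, 2⟩],
    [
      .cite 68 8 4 2 1, .move 0 3 2, .cite 63 2 8 4 1, .cite 68 2 8 4 1, .cite 61 8 4 2 1,
      .move 5 1 3, .cite 55 4 2 8 1, .cite 55 8 2 4 1, .cite 55 4 8 2 1, .move 0 3 11,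
      .move 14 4 13, .move 0 9 11, .cite 36 8 1 4 2, .move 4 11 10, .move 3 11 10, .move 18 13 1,
      .move 20 4 5, .move 7 1 3, .move 15 9 5, .move 22 2 10, .move 21 6 4, .move 2 5 1,
      .move 1 1 9, .move 23 2 6, .move 10 3 2, .move 19 6 7, .move 8 7 5, .move 8 7 1,
      .move 17 9 13, .move 17 9 8, .move 24 9 8, .move 13 2 7, .move 12 1 5, .cite 36 4 1 2 8,
      .move 26 7 1, .move 13 8 12, .move 5 8 9, .move 26 7 3, .move 27 2 3, .cite 33 1 2 4 8,
      .move 16 8 9]),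
   ([
      ⟨[1, 2, 4, 6, 9, 10], 10, 2⟩, ⟨[2, 4, 5, 6, 8, 10], 5, 2⟩, ⟨[1, 4, 6, 8, 8, 10], 5, 2⟩,
      ⟨[1, 2, 4, 6, 8, 13], 5, 3⟩, ⟨[1, 2, 4, 5, 9, 10], 1, 2⟩, ⟨[1, 2, 4, 5, 8, 9], 7, 3⟩,
      ⟨[1, 1, 2, 5, 10, 12], 3, 3⟩, ⟨[2, 3, 4, 6, 8, 9], 9, 2⟩, ⟨[3, 4, 5, 8, 10, 12], 5, 2⟩,
      ⟨[1, 2, 5, 6, 9, 12], 4, 2⟩, ⟨[4, 4, 5, 8, 9, 10], 6, 2⟩, ⟨[2, 3, 4, 5, 8, 9], 12, 2⟩,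
      ⟨[1, 4, 7, 8, 10, 12], 8, 2⟩, ⟨[3, 4, 6, 8, 9, 10], 1, 1⟩, ⟨[3, 4, 5, 6, 8, 10], 1, 1⟩,
      ⟨[3, 4, 5, 8, 9, 12], 1, 2⟩, ⟨[1, 4, 7, 8, 10, 12], 3, 2⟩, ⟨[2, 4, 7, 8, 9, 10], 1, 1⟩,
      ⟨[2, 4, 5, 7, 8, 10], 1, 1⟩, ⟨[1, 2, 4, 7, 8, 13], 9, 2⟩, ⟨[1, 2, 3, 4, 6, 9], 1, 2⟩,
      ⟨[1, 2, 2, 6, 8, 9], 14, 3⟩, ⟨[1, 2, 4, 8, 13, 14], 14, 3⟩, ⟨[1, 2, 4, 7, 8, 12], 3, 2⟩,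
      ⟨[3, 4, 5, 8, 10, 12], 12, 3⟩, ⟨[1, 2, 4, 5, 10, 12], 14, 3⟩, ⟨[1, 4, 5, 8, 8, 10], 14, 3⟩,
      ⟨[2, 4, 6, 8, 9, 11], 1, 1⟩, ⟨[2, 3, 4, 6, 8, 11], 1, 1⟩, ⟨[1, 2, 4, 5, 9, 10], 6, 2⟩,
      ⟨[1, 2, 4, 5, 8, 10], 14, 3⟩, ⟨[1, 2, 3, 4, 8, 10], 7, 3⟩, ⟨[1, 2, 4, 6, 8, 9], 13, 3⟩,
      ⟨[1, 2, 4, 5, 8, 10], 13, 3⟩, ⟨[1, 2, 4, 6, 8, 9], 14, 3⟩, ⟨[1, 2, 4, 6, 8, 9], 11, 3⟩],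
    [
      .move 1 1 3, .move 29 6 5, .cite 56 4 2 8 1, .move 3 9 12, .cite 56 2 4 1 8,
      .cite 68 8 4 1 2, .cite 62 1 2 8 4, .move 0 1 3, .cite 55 8 2 4 1, .move 29 10 3,
      .cite 33 8 2 4 1, .cite 18 1 8 2 4, .move 0 1 7, .move 7 10 8, .move 32 9 1, .move 12 3 1,
      .move 33 5 7, .move 34 5 7, .move 35 6 12, .move 36 4 12, .move 9 7 6, .cite 38 1 2 4 8,
      .move 38 12 8, .move 27 6 2, .cite 0 1 2 4 8, .move 23 6 5, .move 23 9 5, .move 40 2 10,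
      .move 18 3 2, .move 28 6 7, .move 14 7 3, .move 30 10 9, .move 20 3 1, .move 25 4 6,
      .cite 10 1 2 8 4, .move 25 9 1, .cite 23 1 2 4 8, .move 22 5 1, .move 42 14 12]),
   ([
      ⟨[1, 2, 4, 6, 8, 13], 13, 3⟩, ⟨[1, 2, 4, 5, 9, 10], 1, 2⟩, ⟨[1, 2, 4, 5, 8, 9], 7, 3⟩,
      ⟨[1, 1, 2, 5, 10, 12], 3, 3⟩, ⟨[2, 3, 4, 6, 8, 9], 9, 2⟩, ⟨[3, 4, 5, 8, 10, 12], 5, 2⟩,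
      ⟨[1, 2, 5, 6, 9, 12], 4, 2⟩, ⟨[4, 4, 5, 8, 9, 10], 6, 2⟩, ⟨[2, 3, 4, 5, 8, 9], 12, 2⟩,
      ⟨[1, 4, 7, 8, 10, 12], 8, 2⟩, ⟨[3, 4, 6, 8, 9, 10], 1, 1⟩, ⟨[3, 4, 5, 6, 8, 10], 1, 1⟩,
      ⟨[3, 4, 5, 8, 9, 12], 1, 2⟩, ⟨[1, 2, 4, 5, 6, 8], 14, 3⟩, ⟨[1, 4, 7, 8, 10, 12], 3, 2⟩,
      ⟨[2, 4, 7, 8, 9, 10], 1, 1⟩, ⟨[2, 4, 5, 7, 8, 10], 1, 1⟩, ⟨[1, 2, 4, 7, 8, 13], 9, 2⟩,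
      ⟨[1, 2, 3, 4, 6, 9], 1, 2⟩, ⟨[1, 2, 2, 6, 8, 9], 14, 3⟩, ⟨[1, 2, 4, 8, 13, 14], 14, 3⟩,
      ⟨[1, 2, 4, 7, 8, 12], 3, 2⟩, ⟨[3, 4, 5, 8, 10, 12], 12, 3⟩, ⟨[1, 2, 3, 4, 6, 8], 11, 3⟩,
      ⟨[1, 2, 4, 5, 10, 12], 14, 3⟩, ⟨[1, 4, 5, 8, 8, 10], 14, 3⟩, ⟨[2, 4, 6, 8, 9, 11], 1, 1⟩,
      ⟨[2, 4, 5, 6, 8, 11], 1, 1⟩, ⟨[2, 3, 4, 6, 8, 11], 1, 1⟩, ⟨[1, 2, 4, 5, 9, 10], 6, 2⟩,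
      ⟨[1, 2, 4, 5, 8, 10], 14, 3⟩, ⟨[1, 2, 3, 4, 8, 10], 7, 3⟩, ⟨[1, 2, 4, 6, 8, 9], 13, 3⟩,
      ⟨[1, 2, 4, 5, 8, 10], 13, 3⟩, ⟨[1, 2, 4, 6, 8, 9], 14, 3⟩, ⟨[1, 2, 4, 6, 8, 9], 11, 3⟩],
    [
      .cite 57 1 2 4 8, .cite 65 2 8 4 1, .cite 57 8 2 4 1, .move 0 1 3, .move 1 1 3,
      .move 29 13 5, .move 29 13 8, .cite 57 4 2 8 1, .move 0 8 10, .move 33 2 10, .move 19 1 11,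
      .move 19 1 3, .move 5 11 10, .cite 0 1 2 4 8, .cite 18 1 2 4 8, .move 30 6 3,
      .move 30 10 3, .move 37 3 2, .move 14 6 10, .move 13 1 3, .move 31 9 5, .move 39 2 10,
      .move 38 9 8, .move 2 1 5, .move 32 10 6, .move 32 4 6, .move 40 5 4, .move 41 10 9,
      .move 35 5 1, .move 26 9 1]),
   ([
      ⟨[1, 1, 2, 5, 10, 14], 1, 2⟩, ⟨[2, 3, 4, 6, 8, 9], 9, 2⟩, ⟨[3, 4, 5, 8, 10, 12], 5, 2⟩,
      ⟨[1, 2, 5, 6, 9, 12], 4, 2⟩, ⟨[1, 2, 4, 6, 9, 9], 12, 2⟩, ⟨[4, 4, 5, 8, 9, 10], 6, 2⟩,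
      ⟨[2, 3, 4, 5, 8, 9], 12, 2⟩, ⟨[1, 4, 7, 8, 10, 12], 8, 2⟩, ⟨[3, 4, 6, 8, 9, 10], 1, 1⟩,
      ⟨[3, 4, 5, 6, 8, 10], 1, 1⟩, ⟨[3, 4, 5, 8, 9, 12], 1, 2⟩, ⟨[1, 2, 4, 5, 6, 8], 14, 3⟩,
      ⟨[1, 4, 7, 8, 10, 12], 3, 2⟩, ⟨[2, 4, 7, 8, 9, 10], 1, 1⟩, ⟨[2, 4, 5, 7, 8, 10], 1, 1⟩,
      ⟨[1, 2, 4, 7, 8, 13], 9, 2⟩, ⟨[1, 2, 3, 4, 6, 9], 1, 2⟩, ⟨[1, 2, 2, 6, 8, 9], 14, 3⟩,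
      ⟨[1, 2, 4, 9, 10, 13], 12, 3⟩, ⟨[1, 2, 4, 8, 13, 14], 14, 3⟩, ⟨[1, 2, 4, 7, 8, 12], 3, 2⟩,
      ⟨[2, 4, 5, 6, 9, 10], 6, 3⟩, ⟨[1, 1, 2, 5, 10, 14], 10, 2⟩, ⟨[3, 4, 5, 8, 10, 12], 12, 3⟩,
      ⟨[1, 2, 2, 3, 4, 13], 14, 3⟩, ⟨[1, 2, 3, 4, 6, 8], 11, 3⟩, ⟨[1, 2, 4, 5, 10, 12], 14, 3⟩,
      ⟨[1, 2, 2, 4, 5, 10], 14, 3⟩, ⟨[1, 4, 5, 8, 8, 10], 14, 3⟩, ⟨[2, 4, 6, 8, 9, 11], 1, 1⟩,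
      ⟨[2, 4, 5, 6, 8, 11], 1, 1⟩, ⟨[2, 3, 4, 6, 8, 11], 1, 1⟩, ⟨[1, 2, 4, 5, 8, 10], 14, 3⟩,
      ⟨[1, 2, 3, 4, 8, 10], 7, 3⟩, ⟨[1, 2, 4, 6, 8, 9], 13, 3⟩, ⟨[1, 2, 4, 5, 8, 10], 13, 3⟩,
      ⟨[1, 2, 4, 5, 8, 10], 7, 3⟩, ⟨[1, 2, 4, 6, 8, 9], 14, 3⟩, ⟨[1, 2, 4, 6, 8, 9], 11, 3⟩],
    [
      .cite 20 1 8 2 4, .move 1 5 13, .move 12 14 12, .cite 71 1 2 4 8, .move 1 8 9,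
      .move 15 14 10, .move 0 4 7, .move 1 1 3, .move 0 8 10, .cite 58 1 2 4 8, .move 33 8 9,
      .move 12 14 4, .move 0 8 13, .move 15 14 6, .move 35 1 3, .move 40 4 5, .move 35 1 9,
      .move 36 10 8, .move 41 1 9, .cite 0 1 2 4 8, .move 32 6 5, .cite 35 8 2 4 1, .move 8 12 9,
      .move 36 5 3, .move 36 5 13, .move 8 12 13, .move 16 10 11, .cite 23 4 1 8 2,
      .cite 42 1 4 2 8, .cite 21 4 1 8 2, .move 39 6 3, .move 38 5 1, .move 2 8 9]),
   ([
      ⟨[1, 2, 4, 6, 8, 9], 13, 3⟩, ⟨[1, 2, 4, 5, 8, 10], 13, 3⟩, ⟨[1, 2, 3, 4, 8, 12], 13, 3⟩,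
      ⟨[1, 2, 3, 4, 8, 12], 11, 3⟩, ⟨[1, 2, 4, 5, 8, 10], 7, 3⟩, ⟨[1, 2, 4, 6, 8, 9], 14, 3⟩,
      ⟨[1, 2, 4, 6, 8, 9], 11, 3⟩],
    [
      .cite 65 1 2 4 8, .cite 58 8 2 4 1, .cite 72 1 8 2 4, .cite 6 1 2 4 8, .cite 55 1 4 8 2,
      .cite 71 8 4 1 2, .cite 59 4 2 8 1, .move 0 6 7, .cite 59 8 4 1 2, .move 2 2 14,
      .cite 59 1 2 8 4, .move 0 1 7, .move 0 2 6, .cite 21 2 4 1 8, .move 4 9 1, .move 0 9 8,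
      .move 0 2 7, .move 2 8 14, .cite 70 1 2 8 4, .cite 34 1 2 4 8, .move 0 4 7,
      .cite 58 4 2 8 1, .cite 12 1 4 2 8, .move 15 6 10, .cite 59 4 8 1 2, .cite 55 1 8 4 2,
      .move 15 6 12, .cite 58 1 4 8 2, .cite 59 1 2 4 8, .cite 53 2 1 4 8, .cite 12 8 4 1 2,
      .cite 21 1 4 8 2, .cite 72 1 4 2 8, .cite 21 1 8 2 4, .cite 62 4 8 1 2, .cite 21 1 8 4 2,
      .move 1 2 10, .move 0 1 3, .cite 50 8 4 1 2, .move 0 8 10, .cite 35 8 4 1 2,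
      .cite 12 1 8 2 4, .move 36 12 14, .move 16 6 14, .move 2 12 14, .cite 49 2 1 8 4,
      .move 20 6 7, .cite 49 2 1 4 8, .cite 35 4 2 8 1, .move 24 7 3, .move 24 7 6, .move 11 3 2,
      .move 42 6 10, .move 40 10 6, .move 42 6 2, .move 40 10 2, .move 46 12 8, .move 46 12 5,
      .move 46 12 13, .move 46 12 9, .cite 5 1 2 4 8, .move 1 10 11, .move 1 8 11, .move 1 1 11,
      .cite 35 8 2 4 1, .cite 21 2 8 1 4, .cite 8 2 4 1 8, .move 30 5 6, .move 1 2 11,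
      .move 23 1 5, .move 22 5 1, .move 23 1 3, .move 1 1 3, .move 57 10 6, .move 30 8 10,
      .cite 12 4 8 1 2, .move 1 4 6, .move 23 11 3, .cite 35 2 8 4 1, .move 1 4 5, .move 23 1 9,
      .cite 35 8 2 1 4, .move 60 10 11, .move 23 2 14, .move 30 2 14, .move 30 5 4,
      .move 54 10 3, .move 30 2 10, .move 54 14 6, .move 23 11 10, .cite 43 8 4 1 2,
      .cite 43 2 4 1 8, .move 45 2 3, .move 54 14 12, .move 65 5 13, .move 40 11 7, .move 66 1 9,
      .move 48 11 9, .move 54 14 2, .move 63 11 9, .move 67 11 1, .move 64 4 14, .move 40 11 3,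
      .cite 35 2 8 1 4, .move 60 14 8, .move 37 14 2, .move 60 14 6, .move 50 11 9,
      .move 60 14 12, .move 73 10 3, .move 50 11 3, .move 73 4 5, .move 14 9 13, .move 50 11 8,
      .move 38 4 6, .cite 15 4 1 2 8, .move 39 8 12, .move 39 3 7, .move 52 14 6, .move 76 1 3,
      .move 14 1 5, .move 38 2 6, .move 39 2 6, .cite 43 4 1 2 8, .move 79 8 9, .move 39 14 12,
      .move 82 8 9, .cite 35 8 4 2 1, .move 49 14 12, .move 20 14 10, .move 39 4 12,
      .move 32 6 7, .move 43 14 2, .move 83 14 9, .move 36 13 1, .move 20 14 12, .cite 4 1 2 4 8,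
      .cite 8 2 8 1 4, .move 9 9 10, .move 87 12 10, .move 9 4 6, .cite 35 4 8 2 1, .move 9 9 8,
      .move 90 8 14, .move 24 1 5, .move 24 2 14, .move 9 2 14, .move 9 2 6, .move 24 1 9,
      .move 33 6 5, .move 31 12 14, .move 9 9 13, .move 49 7 5, .cite 43 2 8 1 4, .move 51 14 6,
      .move 89 13 1, .move 41 7 5, .move 94 7 1, .move 47 14 12, .move 5 12 14, .move 77 14 6,
      .cite 43 4 8 1 2, .move 51 1 9, .move 99 1 9, .move 72 14 12, .move 96 6 3, .move 98 14 10,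
      .move 101 1 5, .move 93 1 3, .move 93 9 10, .move 42 7 3, .move 81 14 2, .move 76 5 7,
      .move 6 14 10, .move 6 6 10, .move 26 14 6, .move 68 3 5, .move 68 3 9, .move 68 1 9,
      .move 104 2 3, .move 25 6 5, .move 68 1 5, .move 10 6 4, .move 10 10 9, .cite 27 8 1 4 2,
      .move 111 8 9, .cite 27 4 1 8 2, .move 111 12 9, .move 113 12 9, .move 111 5 3,
      .move 109 1 9, .cite 27 8 2 1 4, .move 113 9 3, .move 113 4 5, .cite 27 4 2 1 8,
      .move 118 12 6, .move 121 2 10, .cite 0 1 2 4 8, .move 78 14 12, .move 78 14 2,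
      .move 122 1 9, .move 78 14 8, .move 122 1 13, .move 19 1 5, .cite 39 4 8 1 2, .move 12 6 3,
      .cite 49 4 2 1 8, .move 125 5 4, .move 102 3 5, .move 102 3 1, .move 19 1 9, .move 19 8 12,
      .move 85 13 12, .move 61 8 13, .move 3 1 9, .move 29 10 8, .move 27 7 6, .move 114 10 2,
      .move 126 5 4, .move 128 8 10, .move 129 5 6, .move 123 10 6, .move 32 13 8,
      .cite 41 1 2 4 8, .move 130 5 13, .move 16 2 10, .move 32 13 5, .move 95 1 11,
      .move 131 12 8, .cite 39 8 4 1 2, .move 56 11 10, .move 7 6 2, .move 28 10 3,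
      .cite 3 1 2 4 8, .move 35 9 5, .move 100 3 1, .move 35 6 5, .move 135 2 10, .move 136 4 12,
      .cite 26 1 2 8 4, .move 108 3 2, .move 138 1 3, .move 133 6 7, .move 91 7 3, .move 139 1 5,
      .move 8 10 9]),
   ([
      ⟨[1, 1, 2, 5, 10, 12], 12, 1⟩, ⟨[1, 2, 3, 5, 9, 12], 4, 1⟩, ⟨[1, 2, 3, 5, 8, 10], 6, 2⟩,
      ⟨[1, 2, 3, 5, 8, 12], 13, 3⟩, ⟨[1, 2, 3, 5, 8, 13], 4, 1⟩],
    [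
      .cite 68 1 8 4 2, .move 4 1 3, .move 4 2 3, .move 7 12 8, .move 6 12 8, .move 5 10 2,
      .move 2 10 12, .move 8 1 9, .move 2 10 8, .move 1 8 9, .move 10 8 13, .move 0 13 9,
      .move 9 8 12]),
   ([
      ⟨[1, 1, 2, 5, 10, 14], 1, 2⟩, ⟨[1, 2, 4, 5, 9, 10], 10, 2⟩, ⟨[1, 2, 4, 9, 12, 14], 12, 3⟩,
      ⟨[1, 2, 4, 9, 10, 12], 8, 2⟩, ⟨[1, 1, 2, 5, 10, 14], 10, 2⟩, ⟨[1, 2, 4, 5, 10, 13], 9, 3⟩,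
      ⟨[1, 2, 4, 9, 10, 13], 9, 3⟩, ⟨[1, 2, 4, 5, 10, 12], 14, 3⟩, ⟨[1, 2, 4, 6, 9, 12], 3, 2⟩,
      ⟨[1, 2, 4, 5, 8, 10], 14, 3⟩, ⟨[1, 2, 4, 5, 8, 10], 13, 3⟩, ⟨[1, 2, 4, 5, 8, 10], 7, 3⟩],
    [
      .cite 74 1 2 4 8, .cite 60 2 1 4 8, .cite 15 1 2 4 8, .move 8 9 13, .move 8 5 13,
      .move 5 14 4, .cite 61 2 4 1 8, .move 3 13 12, .move 4 13 12, .move 9 1 9,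
      .cite 34 2 8 4 1, .move 10 12 10]),
   ([
      ⟨[1, 2, 3, 4, 10, 12], 5, 2⟩, ⟨[1, 4, 5, 6, 8, 9], 3, 2⟩, ⟨[1, 2, 4, 5, 6, 12], 14, 3⟩,
      ⟨[1, 2, 3, 4, 10, 12], 11, 3⟩, ⟨[1, 2, 3, 4, 10, 12], 12, 2⟩, ⟨[1, 2, 4, 6, 9, 12], 9, 2⟩,
      ⟨[1, 4, 6, 9, 10, 12], 9, 2⟩, ⟨[1, 2, 4, 6, 9, 10], 3, 2⟩, ⟨[1, 2, 4, 9, 10, 12], 5, 2⟩,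
      ⟨[1, 4, 5, 6, 8, 10], 14, 3⟩, ⟨[1, 4, 4, 6, 9, 11], 9, 2⟩, ⟨[1, 2, 4, 9, 10, 12], 8, 2⟩,
      ⟨[1, 3, 4, 4, 10, 12], 5, 3⟩, ⟨[1, 4, 5, 6, 8, 14], 2, 1⟩, ⟨[1, 2, 4, 6, 8, 12], 9, 2⟩,
      ⟨[1, 2, 4, 6, 8, 12], 3, 2⟩, ⟨[1, 2, 4, 6, 9, 12], 3, 2⟩, ⟨[1, 2, 4, 10, 11, 12], 10, 3⟩],
    [
      .move 10 10 6, .cite 75 4 1 2 8, .cite 35 1 8 2 4, .move 15 10 9, .move 15 10 8,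
      .move 1 12 4, .move 15 10 3, .move 14 2 11, .move 2 6 4, .cite 29 4 1 8 2, .cite 1 4 1 2 8,
      .move 13 3 5, .move 11 2 10]),
   ([
      ⟨[1, 2, 4, 6, 8, 9], 2, 1⟩, ⟨[1, 2, 3, 4, 8, 12], 13, 3⟩, ⟨[1, 2, 4, 6, 8, 9], 14, 3⟩,
      ⟨[1, 2, 4, 6, 8, 9], 11, 3⟩, ⟨[1, 2, 4, 5, 8, 10], 13, 3⟩, ⟨[1, 1, 2, 5, 10, 14], 1, 2⟩,
      ⟨[1, 2, 4, 5, 8, 10], 7, 3⟩, ⟨[1, 2, 4, 5, 8, 10], 14, 3⟩],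
    [
      .cite 25 2 8 1 4, .move 0 8 10, .cite 63 1 2 4 8, .move 0 8 13, .cite 73 1 2 4 8,
      .move 2 4 13, .cite 59 4 2 1 8, .cite 57 4 2 8 1, .cite 62 1 4 8 2, .cite 17 1 2 4 8,
      .cite 73 4 1 2 8, .move 0 8 11, .cite 50 2 8 4 1, .cite 16 2 1 4 8, .cite 57 2 1 8 4,
      .cite 62 2 1 8 4, .move 9 6 4, .cite 39 8 2 1 4, .cite 47 2 4 1 8, .cite 76 1 2 4 8,
      .cite 25 2 4 1 8, .cite 25 1 4 2 8, .move 19 11 3, .move 17 9 10, .cite 57 1 4 8 2,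
      .move 13 10 8, .cite 44 2 8 4 1, .move 19 11 8, .move 25 5 6, .move 18 14 10, .move 2 8 9,
      .move 18 14 12, .move 26 10 9, .move 2 9 12, .move 2 1 9, .move 23 10 8, .cite 3 4 1 8 2,
      .move 2 8 12, .move 1 14 4, .move 2 6 2, .move 5 1 11, .move 20 1 13, .cite 53 1 2 8 4,
      .move 3 12 14, .move 33 9 11, .move 3 2 14, .move 11 5 1, .move 34 9 1, .move 12 3 2,
      .move 38 12 13, .move 36 10 12, .cite 9 4 1 8 2, .move 3 3 6, .cite 12 4 1 2 8,
      .move 31 8 12, .move 38 12 9, .move 21 14 10, .move 31 3 1, .cite 39 8 4 2 1,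
      .move 42 8 12, .move 31 3 5, .move 40 14 12, .move 42 1 13, .move 43 13 4, .move 43 13 12,
      .move 46 2 10, .move 4 2 6, .move 39 14 10, .move 39 14 6, .move 22 10 11, .move 37 13 5,
      .move 22 13 9, .move 41 8 12, .cite 12 1 2 4 8, .move 45 2 14, .move 49 8 9,
      .cite 12 2 4 1 8, .move 24 3 2, .cite 39 8 1 4 2, .move 54 11 10, .cite 47 1 2 4 8,
      .move 54 11 1, .move 54 11 9, .move 50 2 10, .move 53 12 5, .move 53 12 9, .move 55 13 4,
      .move 27 4 13, .cite 39 2 8 1 4, .move 60 2 6, .move 16 6 4, .move 61 14 6, .move 63 9 10,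
      .cite 1 1 2 4 8, .move 13 5 4, .move 14 4 12, .move 13 5 12, .move 13 5 6, .move 51 9 1,
      .move 8 12 5, .move 8 1 3, .move 51 2 6, .move 51 9 11, .move 20 10 6, .move 51 10 14,
      .move 51 10 6, .move 10 11 3, .move 68 1 9, .move 59 9 1, .move 44 1 5, .cite 24 4 1 8 2,
      .move 70 3 5, .move 58 14 6, .cite 0 1 2 4 8, .cite 29 4 1 8 2, .move 66 10 8, .move 3 3 4,
      .move 3 3 6, .move 73 3 5, .move 72 2 10, .move 29 8 9, .cite 17 4 1 2 8, .cite 30 4 1 8 2,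
      .cite 2 4 1 2 8]),
   ([
      ⟨[1, 2, 3, 4, 8, 12], 13, 3⟩, ⟨[1, 2, 4, 6, 8, 9], 14, 3⟩, ⟨[1, 2, 4, 6, 8, 9], 11, 3⟩,
      ⟨[1, 2, 4, 5, 8, 10], 13, 3⟩, ⟨[1, 1, 2, 5, 10, 14], 1, 2⟩, ⟨[1, 2, 4, 5, 8, 10], 7, 3⟩,
      ⟨[1, 2, 4, 5, 8, 10], 14, 3⟩],
    [
      .cite 65 4 1 2 8, .cite 0 1 2 4 8, .cite 4 1 2 8 4, .cite 4 1 2 4 8]),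
   ([
      ⟨[1, 2, 4, 6, 8, 9], 8, 1⟩, ⟨[1, 2, 4, 8, 13, 14], 12, 3⟩, ⟨[1, 2, 4, 7, 8, 9], 3, 3⟩,
      ⟨[1, 2, 3, 4, 8, 13], 2, 1⟩, ⟨[1, 1, 2, 4, 8, 14], 10, 2⟩, ⟨[1, 1, 2, 4, 8, 14], 1, 2⟩,
      ⟨[1, 2, 4, 7, 8, 9], 5, 3⟩, ⟨[1, 2, 3, 4, 8, 13], 5, 3⟩],
    [
      .cite 18 8 2 1 4, .move 4 6 7, .move 0 3 2, .move 1 2 6, .move 5 2 14, .cite 49 4 8 1 2,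
      .move 3 13 1, .move 7 7 1, .move 8 6 2]),
   ([
      ⟨[1, 2, 4, 6, 8, 9], 14, 3⟩, ⟨[1, 2, 4, 6, 8, 9], 11, 3⟩, ⟨[1, 2, 4, 5, 8, 10], 13, 3⟩,
      ⟨[1, 1, 2, 5, 10, 14], 1, 2⟩, ⟨[1, 2, 4, 5, 8, 10], 7, 3⟩, ⟨[1, 2, 4, 5, 8, 10], 14, 3⟩],
    [
      .cite 67 4 1 2 8, .cite 67 1 4 8 2, .move 0 8 11, .cite 28 2 4 1 8, .cite 19 4 8 1 2,
      .cite 19 4 2 1 8, .move 0 10 11, .cite 47 2 8 4 1, .cite 1 1 2 4 8, .move 1 5 4,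
      .move 0 5 1, .move 0 2 10, .cite 65 2 4 8 1, .move 3 12 13, .cite 19 2 4 1 8, .move 3 1 13,
      .move 10 10 14, .move 9 10 8, .cite 56 2 1 8 4, .cite 19 2 8 1 4, .move 12 3 1,
      .move 14 10 2, .move 15 12 14, .cite 0 1 2 4 8, .cite 22 4 1 8 2, .move 5 9 11,
      .move 16 14 4, .move 18 4 5, .cite 6 4 8 1 2, .cite 15 8 4 1 2]),
   ([
      ⟨[1, 1, 2, 5, 8, 10], 2, 1⟩, ⟨[1, 2, 5, 6, 8, 12], 4, 2⟩, ⟨[1, 2, 5, 6, 8, 12], 10, 2⟩,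
      ⟨[1, 2, 5, 8, 9, 10], 12, 2⟩, ⟨[1, 2, 5, 8, 10, 13], 8, 2⟩, ⟨[1, 2, 3, 5, 8, 12], 10, 2⟩,
      ⟨[1, 2, 5, 6, 8, 9], 7, 3⟩, ⟨[1, 1, 2, 5, 8, 10], 4, 1⟩],
    [
      .move 0 1 13, .move 0 1 9, .cite 67 2 1 8 4, .cite 51 1 2 8 4, .move 4 10 6, .move 4 10 12,
      .cite 40 2 4 1 8, .move 6 13 12]),
   ([
      ⟨[1, 2, 4, 5, 9, 10], 5, 2⟩, ⟨[1, 2, 3, 5, 8, 10], 2, 2⟩, ⟨[1, 2, 4, 9, 10, 12], 8, 2⟩,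
      ⟨[1, 4, 6, 8, 9, 10], 5, 2⟩, ⟨[1, 3, 4, 6, 9, 10], 2, 2⟩, ⟨[1, 4, 6, 8, 10, 11], 10, 3⟩,
      ⟨[1, 2, 4, 6, 10, 12], 3, 2⟩, ⟨[1, 2, 6, 8, 10, 12], 3, 2⟩, ⟨[1, 2, 3, 4, 5, 12], 9, 2⟩,
      ⟨[1, 2, 5, 8, 9, 10], 12, 2⟩, ⟨[1, 4, 5, 6, 8, 10], 14, 3⟩, ⟨[1, 3, 5, 6, 8, 10], 2, 2⟩,
      ⟨[1, 2, 3, 4, 10, 12], 8, 1⟩, ⟨[1, 3, 4, 6, 8, 12], 9, 2⟩, ⟨[1, 2, 3, 5, 8, 12], 10, 2⟩,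
      ⟨[1, 3, 4, 4, 11, 12], 11, 2⟩, ⟨[1, 1, 5, 8, 10, 14], 14, 2⟩, ⟨[1, 3, 4, 5, 6, 8], 10, 2⟩,
      ⟨[1, 3, 4, 6, 8, 10], 2, 2⟩, ⟨[1, 2, 6, 8, 11, 12], 3, 2⟩, ⟨[1, 4, 4, 6, 9, 10], 5, 3⟩,
      ⟨[1, 2, 5, 6, 8, 9], 7, 3⟩, ⟨[1, 3, 4, 6, 8, 9], 7, 3⟩, ⟨[1, 2, 4, 6, 8, 12], 9, 2⟩,
      ⟨[1, 4, 6, 6, 8, 9], 9, 2⟩, ⟨[1, 4, 6, 7, 8, 9], 6, 2⟩, ⟨[1, 2, 4, 6, 8, 12], 3, 2⟩,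
      ⟨[1, 2, 4, 5, 10, 12], 14, 3⟩, ⟨[1, 2, 4, 4, 5, 10], 14, 3⟩, ⟨[1, 1, 2, 4, 5, 10], 11, 3⟩,
      ⟨[1, 1, 2, 5, 8, 10], 4, 1⟩],
    [
      .move 14 11 10, .cite 64 2 4 1 8, .move 2 5 9, .cite 74 4 1 2 8, .cite 78 1 2 4 8,
      .cite 76 4 1 8 2, .cite 79 4 1 2 8, .move 29 5 4, .cite 64 4 8 1 2, .cite 66 2 8 1 4,
      .move 24 10 9, .cite 68 2 4 1 8, .cite 81 1 2 4 8, .cite 68 8 4 1 2, .cite 81 4 2 1 8,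
      .move 14 11 2, .cite 74 4 1 8 2, .move 29 5 12, .move 23 2 3, .cite 68 4 1 8 2,
      .cite 67 4 1 8 2, .move 13 14 8, .move 32 4 12, .move 27 9 13, .cite 68 4 2 1 8,
      .move 27 4 6, .move 27 9 5, .move 27 9 1, .move 3 10 3, .move 38 1 7, .move 27 12 4,
      .move 27 2 6, .move 39 9 8, .move 32 9 5, .move 33 12 5, .move 2 2 3, .move 21 5 4,
      .cite 55 1 4 2 8, .move 41 9 1, .move 41 9 8, .move 35 2 10, .move 22 10 11, .move 35 2 6,
      .move 35 4 14, .move 30 3 6, .move 30 4 6, .move 1 2 6, .cite 35 4 1 2 8, .move 10 11 1,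
      .move 50 1 5, .move 49 4 5, .move 34 3 10, .move 52 4 12, .move 49 4 12, .move 37 3 1,
      .cite 0 1 2 4 8, .move 47 12 9, .move 4 2 10, .move 45 12 11, .move 4 8 10, .move 23 6 3,
      .move 24 8 9, .move 44 12 5, .move 9 4 12, .move 41 12 8, .move 17 10 14, .move 48 6 4,
      .cite 52 4 1 2 8, .move 55 14 10, .move 54 1 3, .move 31 2 3, .move 56 12 4, .move 42 5 13,
      .move 57 13 9, .move 58 4 6, .move 57 13 8, .move 59 4 6, .cite 38 8 2 4 1, .move 19 5 9,
      .move 26 8 11, .move 26 10 11, .move 36 11 3, .move 7 8 10, .move 53 11 3]),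
   ([
      ⟨[1, 2, 4, 9, 12, 14], 3, 1⟩, ⟨[1, 3, 4, 4, 11, 12], 11, 2⟩],
    [
      .move 1 9 12, .move 1 9 13, .cite 63 1 4 8 2, .move 2 2 3, .cite 53 4 2 1 8,
      .cite 52 4 2 1 8, .move 6 2 14]),
   ([
      ⟨[1, 2, 4, 9, 10, 12], 8, 2⟩, ⟨[1, 4, 6, 8, 9, 10], 5, 2⟩, ⟨[1, 3, 4, 6, 9, 10], 2, 2⟩,
      ⟨[1, 4, 6, 8, 10, 11], 10, 3⟩, ⟨[1, 2, 4, 6, 10, 12], 3, 2⟩, ⟨[1, 2, 6, 8, 10, 12], 3, 2⟩,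
      ⟨[1, 2, 4, 9, 10, 12], 3, 2⟩, ⟨[1, 2, 5, 6, 8, 12], 10, 2⟩, ⟨[1, 2, 3, 4, 5, 12], 9, 2⟩,
      ⟨[1, 2, 5, 8, 9, 10], 12, 2⟩, ⟨[1, 4, 5, 6, 8, 10], 14, 3⟩, ⟨[1, 3, 5, 6, 8, 10], 2, 2⟩,
      ⟨[1, 2, 3, 4, 10, 12], 8, 1⟩, ⟨[1, 3, 4, 6, 8, 12], 9, 2⟩, ⟨[1, 2, 3, 5, 8, 12], 10, 2⟩,
      ⟨[1, 3, 4, 4, 11, 12], 11, 2⟩, ⟨[1, 1, 5, 8, 10, 14], 14, 2⟩, ⟨[1, 3, 4, 5, 6, 8], 10, 2⟩,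
      ⟨[1, 3, 4, 6, 8, 10], 2, 2⟩, ⟨[1, 2, 6, 8, 11, 12], 3, 2⟩, ⟨[1, 4, 4, 6, 9, 10], 5, 3⟩,
      ⟨[1, 2, 5, 6, 8, 9], 7, 3⟩, ⟨[1, 3, 4, 6, 8, 9], 7, 3⟩, ⟨[1, 2, 4, 6, 8, 12], 9, 2⟩,
      ⟨[1, 4, 6, 6, 8, 9], 9, 2⟩, ⟨[1, 2, 4, 5, 10, 12], 14, 3⟩, ⟨[1, 2, 4, 4, 5, 10], 14, 3⟩,
      ⟨[1, 1, 2, 4, 5, 10], 11, 3⟩, ⟨[1, 2, 3, 4, 4, 12], 8, 1⟩, ⟨[1, 2, 4, 6, 8, 12], 3, 2⟩,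
      ⟨[1, 2, 4, 6, 9, 12], 3, 2⟩, ⟨[1, 4, 6, 7, 8, 9], 6, 2⟩, ⟨[1, 1, 2, 5, 8, 10], 4, 1⟩,
      ⟨[1, 2, 4, 5, 9, 10], 6, 2⟩],
    [
      .cite 76 1 8 4 2, .cite 83 1 2 4 8, .move 6 1 9, .move 17 11 10, .cite 0 1 2 4 8,
      .move 28 2 3, .move 17 11 1, .cite 70 2 4 1 8, .move 16 14 6, .move 36 4 14,
      .cite 76 4 1 8 2, .move 16 14 8, .cite 57 4 8 2 1, .move 38 1 7, .cite 2 4 2 8 1,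
      .cite 57 1 4 2 8, .move 5 2 10, .move 33 4 6, .cite 37 4 1 2 8, .move 42 4 5,
      .move 43 4 12, .cite 2 1 2 4 8, .move 1 2 6, .move 32 1 3, .move 21 6 2, .cite 1 1 2 4 8,
      .move 0 10 12, .move 0 9 12, .cite 43 2 8 4 1]),
   ([
      ⟨[1, 2, 4, 6, 8, 9], 13, 3⟩, ⟨[1, 3, 4, 6, 9, 10], 2, 2⟩, ⟨[3, 4, 6, 8, 9, 10], 2, 2⟩,
      ⟨[1, 4, 6, 8, 10, 11], 10, 3⟩, ⟨[1, 2, 4, 6, 10, 12], 3, 2⟩, ⟨[1, 2, 6, 8, 10, 12], 3, 2⟩,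
      ⟨[1, 2, 4, 9, 10, 12], 3, 2⟩, ⟨[1, 2, 5, 6, 8, 12], 10, 2⟩, ⟨[1, 2, 3, 4, 5, 12], 9, 2⟩,
      ⟨[1, 2, 5, 8, 9, 10], 12, 2⟩, ⟨[3, 4, 5, 8, 8, 10], 12, 3⟩, ⟨[2, 3, 4, 8, 9, 12], 11, 3⟩,
      ⟨[1, 4, 5, 6, 8, 10], 14, 3⟩, ⟨[1, 3, 5, 6, 8, 10], 2, 2⟩, ⟨[1, 2, 3, 4, 10, 12], 8, 1⟩,
      ⟨[1, 3, 4, 6, 8, 12], 9, 2⟩, ⟨[1, 2, 3, 5, 8, 12], 10, 2⟩, ⟨[1, 3, 4, 4, 11, 12], 11, 2⟩,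
      ⟨[1, 1, 5, 8, 10, 14], 14, 2⟩, ⟨[1, 3, 4, 5, 6, 8], 10, 2⟩, ⟨[1, 3, 4, 6, 8, 10], 2, 2⟩,
      ⟨[1, 2, 4, 8, 9, 12], 11, 3⟩, ⟨[1, 2, 6, 8, 11, 12], 3, 2⟩, ⟨[1, 4, 4, 6, 9, 10], 5, 3⟩,
      ⟨[1, 2, 5, 6, 8, 9], 7, 3⟩, ⟨[1, 3, 4, 6, 8, 9], 7, 3⟩, ⟨[1, 2, 4, 6, 8, 12], 9, 2⟩,
      ⟨[1, 4, 6, 6, 8, 9], 9, 2⟩, ⟨[1, 2, 4, 5, 10, 12], 14, 3⟩, ⟨[1, 2, 4, 4, 5, 10], 14, 3⟩,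
      ⟨[1, 1, 2, 4, 5, 10], 11, 3⟩, ⟨[1, 2, 3, 4, 4, 12], 8, 1⟩, ⟨[1, 2, 4, 6, 8, 9], 11, 3⟩,
      ⟨[1, 2, 4, 6, 8, 9], 1, 1⟩, ⟨[1, 1, 2, 5, 8, 10], 4, 1⟩, ⟨[1, 2, 4, 5, 8, 10], 7, 3⟩,
      ⟨[1, 2, 4, 5, 8, 10], 14, 3⟩],
    [
      .cite 72 1 2 4 8, .cite 77 8 4 1 2, .move 2 9 12, .cite 4 8 4 1 2, .move 35 7 4,
      .move 35 7 3, .move 2 2 10, .move 0 8 9, .move 2 2 14, .cite 71 8 4 2 1, .move 2 8 12,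
      .move 2 1 5, .cite 71 2 8 4 1, .move 36 8 11, .cite 47 2 4 1 8, .cite 51 1 2 8 4,
      .cite 0 1 2 4 8, .move 28 10 8, .move 40 5 12, .move 13 1 3, .move 23 3 6, .move 28 9 8,
      .move 44 2 3, .move 46 12 8, .move 45 12 8, .move 34 8 10, .cite 38 8 4 2 1]),
   ([
      ⟨[1, 1, 2, 5, 10, 14], 1, 2⟩, ⟨[1, 2, 4, 6, 8, 9], 11, 3⟩, ⟨[1, 2, 3, 4, 8, 12], 13, 3⟩,
      ⟨[1, 2, 4, 6, 8, 9], 1, 1⟩, ⟨[1, 2, 4, 5, 8, 10], 13, 3⟩, ⟨[1, 2, 4, 5, 8, 10], 7, 3⟩,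
      ⟨[1, 2, 4, 5, 8, 10], 14, 3⟩],
    [
      .cite 72 1 8 2 4, .move 0 5 4, .move 1 8 14, .move 5 10 14, .cite 34 1 8 4 2, .move 0 4 12,
      .cite 71 4 2 8 1, .cite 71 8 1 2 4, .cite 59 2 8 4 1, .cite 25 1 4 8 2, .cite 72 4 1 2 8,
      .cite 66 4 8 2 1, .cite 67 1 4 8 2, .cite 73 1 2 4 8, .cite 71 1 2 4 8, .move 1 6 14,
      .move 0 1 11, .move 0 2 10, .cite 34 1 4 8 2, .move 0 4 1, .move 0 8 11, .move 6 9 8,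
      .cite 62 2 1 8 4, .move 9 5 1, .move 22 10 12, .cite 56 2 4 1 8, .move 21 10 2,
      .cite 18 1 2 8 4, .move 23 11 8, .move 20 6 3, .move 23 11 9, .move 23 11 3,
      .cite 34 4 8 1 2, .move 2 1 3, .cite 53 2 8 4 1, .cite 48 8 2 1 4, .move 20 6 7,
      .move 28 10 8, .cite 62 1 4 2 8, .move 2 12 4, .move 30 14 4, .move 22 10 6, .move 32 3 1,
      .move 3 14 4, .move 25 10 9, .move 30 14 12, .cite 21 4 1 8 2, .move 26 14 6,
      .move 26 14 10, .move 16 2 6, .cite 47 1 2 4 8, .move 41 7 3, .move 33 8 12, .move 16 4 6,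
      .cite 56 2 1 8 4, .move 16 9 1, .move 40 14 6, .move 41 7 4, .move 16 14 6,
      .cite 48 4 2 8 1, .move 1 9 12, .move 49 7 5, .move 45 14 12, .move 48 8 10, .move 46 1 7,
      .move 31 14 10, .move 18 10 11, .move 31 14 12, .move 35 7 6, .move 35 7 5, .move 35 7 4,
      .move 56 4 12, .move 8 11 3, .move 8 11 10, .move 8 4 12, .move 38 4 5, .move 12 11 9,
      .move 38 2 10, .move 38 2 5, .move 12 11 3, .cite 21 1 8 4 2, .cite 25 8 2 4 1,
      .cite 21 8 4 1 2, .cite 8 4 1 8 2, .move 59 2 10, .move 2 4 5, .move 64 11 1,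
      .move 55 2 10, .move 2 8 12, .cite 2 1 2 4 8, .move 54 1 3, .move 2 2 6, .cite 5 1 8 4 2,
      .move 2 4 7, .move 67 4 14, .move 2 8 9, .move 2 8 10, .move 10 12 4, .move 64 11 2,
      .cite 48 2 8 1 4, .move 73 14 8, .move 77 14 6, .cite 48 1 2 4 8, .move 70 12 6,
      .move 76 3 10, .cite 52 8 2 4 1, .cite 2 8 2 1 4, .move 77 14 8, .move 43 4 12,
      .move 18 7 6, .move 57 4 12, .move 77 14 10, .move 17 1 11, .move 18 7 3, .move 6 6 10,
      .move 82 1 3, .move 80 11 9, .move 78 1 7, .move 13 9 5, .move 57 8 12, .cite 52 4 2 1 8,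
      .move 14 5 1, .move 81 5 3, .move 89 10 6, .move 27 14 12, .move 39 8 9, .move 39 1 9,
      .move 10 3 6, .move 4 12 9, .move 92 2 6, .move 52 7 5, .move 93 2 6, .cite 0 1 2 4 8,
      .move 1 8 12, .move 98 9 12, .move 1 9 13, .move 99 2 3, .move 63 6 5, .move 15 6 2,
      .cite 49 8 2 4 1, .move 69 12 5, .move 37 10 3]),
   ([
      ⟨[1, 2, 4, 6, 8, 13], 3, 1⟩, ⟨[1, 2, 3, 4, 8, 12], 14, 3⟩, ⟨[1, 2, 4, 6, 8, 9], 11, 3⟩,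
      ⟨[1, 2, 3, 4, 8, 12], 13, 3⟩, ⟨[1, 2, 4, 6, 8, 9], 7, 3⟩],
    [
      .cite 26 8 2 4 1, .move 2 4 12, .cite 3 2 1 8 4, .cite 6 8 2 4 1]),
   ([
      ⟨[1, 2, 4, 6, 8, 13], 6, 2⟩, ⟨[1, 2, 3, 4, 8, 12], 14, 3⟩, ⟨[1, 2, 4, 6, 8, 9], 11, 3⟩,
      ⟨[1, 2, 4, 6, 8, 9], 1, 1⟩, ⟨[1, 2, 4, 5, 8, 10], 7, 3⟩, ⟨[1, 2, 4, 5, 8, 10], 14, 3⟩],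
    [
      .move 3 13 9, .move 1 6 8, .move 3 6 14, .move 5 13 9, .cite 31 4 1 8 2, .cite 23 4 1 8 2]),
   ([
      ⟨[1, 2, 4, 10, 12, 13], 3, 1⟩, ⟨[1, 2, 3, 4, 12, 12], 3, 2⟩, ⟨[1, 2, 3, 4, 12, 14], 10, 2⟩],
    [
      .move 2 10 12, .cite 69 2 4 8 1, .move 2 10 14, .cite 59 4 1 2 8, .move 3 1 3,
      .move 4 13 1, .move 0 14 12]),
   ([
      ⟨[1, 2, 3, 4, 4, 12], 13, 3⟩, ⟨[1, 2, 5, 6, 8, 12], 10, 2⟩, ⟨[1, 2, 5, 8, 9, 10], 12, 2⟩,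
      ⟨[1, 2, 5, 6, 8, 12], 4, 2⟩, ⟨[2, 4, 6, 8, 9, 12], 5, 2⟩, ⟨[2, 2, 3, 4, 12, 13], 2, 2⟩,
      ⟨[2, 3, 4, 5, 8, 11], 12, 2⟩, ⟨[2, 4, 6, 8, 9, 13], 4, 2⟩, ⟨[1, 3, 4, 6, 10, 12], 2, 2⟩,
      ⟨[1, 2, 3, 4, 6, 12], 10, 2⟩, ⟨[1, 2, 3, 5, 8, 12], 10, 2⟩, ⟨[1, 3, 4, 4, 11, 12], 11, 2⟩,
      ⟨[1, 1, 5, 8, 10, 14], 14, 2⟩, ⟨[1, 2, 4, 7, 8, 12], 8, 1⟩, ⟨[2, 4, 6, 8, 8, 9], 7, 2⟩,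
      ⟨[2, 2, 6, 8, 9, 13], 2, 2⟩, ⟨[1, 3, 5, 6, 8, 10], 2, 2⟩, ⟨[1, 2, 2, 5, 10, 13], 2, 2⟩,
      ⟨[1, 1, 2, 5, 8, 10], 14, 2⟩, ⟨[1, 2, 4, 6, 8, 12], 3, 2⟩, ⟨[1, 2, 4, 6, 8, 11], 9, 2⟩,
      ⟨[1, 4, 6, 7, 8, 9], 6, 2⟩, ⟨[1, 2, 4, 8, 9, 14], 1, 1⟩, ⟨[2, 4, 6, 8, 8, 9], 1, 1⟩,
      ⟨[1, 2, 4, 8, 11, 14], 10, 3⟩, ⟨[1, 1, 2, 5, 8, 10], 4, 1⟩, ⟨[2, 4, 5, 8, 9, 10], 6, 2⟩],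
    [
      .cite 6 1 2 4 8, .cite 72 4 2 8 1, .move 13 11 2, .move 24 12 8, .move 23 4 14,
      .cite 82 1 8 4 2, .cite 82 4 1 8 2, .cite 57 4 8 1 2, .move 23 4 6, .move 12 14 8,
      .move 23 2 10, .move 13 11 1, .move 28 1 7, .cite 6 8 2 1 4, .move 15 3 1, .move 12 14 6,
      .move 13 11 10, .move 19 3 1, .cite 63 1 4 2 8, .move 33 12 8, .move 32 2 3, .move 27 4 6,
      .move 15 12 4, .move 29 4 6, .move 31 5 4, .move 37 3 8, .move 36 3 9, .move 37 3 11,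
      .move 39 12 14, .cite 63 4 2 8 1, .move 5 7 4, .move 42 8 10, .cite 43 4 1 2 8,
      .move 38 4 12, .move 38 8 11, .move 7 6 7, .move 38 6 2, .move 40 4 8, .move 6 6 14,
      .move 11 2 3, .cite 52 2 1 4 8, .move 46 11 1, .move 11 1 3, .move 2 11 9, .move 44 4 13,
      .cite 52 1 2 4 8, .cite 60 2 8 4 1, .move 47 4 6, .move 4 4 6, .move 50 7 5,
      .cite 52 4 2 8 1, .move 53 7 5, .move 49 11 9, .move 18 11 9, .cite 8 1 2 4 8, .move 1 2 6,
      .move 1 1 7, .cite 57 1 4 8 2, .move 26 1 3, .cite 43 1 8 2 4, .move 8 10 8, .move 58 1 5,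
      .move 60 1 9, .move 59 5 4, .cite 8 8 2 1 4, .move 35 1 9, .move 3 8 11, .move 61 4 6,
      .cite 57 8 1 4 2]),
   ([
      ⟨[1, 2, 3, 4, 4, 12], 2, 1⟩, ⟨[1, 2, 4, 5, 10, 12], 14, 3⟩, ⟨[1, 2, 4, 9, 10, 12], 8, 2⟩,
      ⟨[1, 2, 3, 4, 5, 12], 9, 2⟩, ⟨[1, 2, 4, 9, 10, 14], 5, 2⟩, ⟨[1, 2, 3, 4, 12, 13], 1, 2⟩,
      ⟨[1, 2, 3, 4, 8, 12], 11, 3⟩, ⟨[1, 2, 3, 4, 4, 12], 8, 1⟩, ⟨[1, 2, 3, 4, 8, 12], 14, 3⟩,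
      ⟨[1, 2, 4, 6, 9, 12], 3, 2⟩, ⟨[1, 2, 4, 6, 8, 9], 11, 3⟩, ⟨[1, 2, 4, 5, 8, 10], 4, 1⟩,
      ⟨[1, 2, 4, 5, 8, 10], 7, 3⟩, ⟨[1, 2, 4, 5, 8, 10], 14, 3⟩],
    [
      .cite 77 2 4 1 8, .move 4 4 5, .cite 9 4 2 8 1, .move 7 3 11, .move 8 12 14,
      .cite 73 1 2 4 8, .move 9 10 11, .move 6 9 11, .move 10 12 8, .cite 61 2 4 1 8,
      .cite 26 8 4 1 2, .move 13 10 8]),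
   ([
      ⟨[1, 2, 4, 8, 9, 14], 6, 2⟩, ⟨[1, 2, 4, 8, 9, 14], 12, 3⟩, ⟨[1, 2, 4, 6, 8, 9], 10, 3⟩,
      ⟨[1, 2, 4, 6, 8, 9], 1, 1⟩, ⟨[1, 2, 4, 5, 8, 10], 7, 3⟩, ⟨[1, 2, 4, 5, 8, 10], 14, 3⟩],
    [
      .move 1 6 14, .cite 79 1 2 4 8, .move 2 14 8, .cite 35 4 1 8 2]),
   ([
      ⟨[1, 2, 4, 6, 8, 9], 11, 3⟩, ⟨[1, 2, 3, 4, 8, 12], 13, 3⟩, ⟨[1, 2, 4, 6, 8, 9], 1, 1⟩,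
      ⟨[1, 2, 4, 5, 8, 10], 13, 3⟩, ⟨[1, 2, 4, 5, 8, 10], 7, 3⟩, ⟨[1, 2, 4, 5, 8, 10], 14, 3⟩],
    [
      .move 0 10 11, .cite 41 1 4 8 2, .move 1 6 14, .cite 32 1 2 8 4, .cite 78 1 2 4 8,
      .move 0 5 4, .cite 80 4 1 2 8, .cite 79 8 4 2 1, .cite 78 4 2 8 1, .move 1 1 5,
      .cite 41 2 8 1 4, .cite 79 1 2 8 4, .cite 6 1 2 4 8, .move 0 4 1, .move 0 1 9,
      .move 13 14 2, .cite 32 1 4 8 2, .cite 78 8 1 2 4, .cite 79 4 1 2 8, .move 0 4 12,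
      .cite 41 1 8 4 2, .move 1 8 14, .move 7 14 8, .cite 79 1 8 2 4, .move 1 1 8, .move 0 1 11,
      .move 7 9 8, .cite 41 1 4 2 8, .move 1 2 14, .move 13 14 8, .move 0 4 6, .move 0 2 10,
      .move 10 5 1, .move 1 9 12, .cite 9 2 8 1 4, .move 8 10 14, .move 16 1 13,
      .cite 69 2 1 8 4, .move 1 8 12, .move 26 10 12, .cite 55 2 4 1 8, .move 23 6 5,
      .move 23 6 7, .move 28 5 4, .cite 59 4 8 1 2, .move 31 10 2, .cite 25 1 2 8 4,
      .move 12 5 9, .move 2 12 4, .move 12 2 3, .cite 47 2 8 1 4, .move 2 1 3, .move 40 9 12,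
      .cite 5 1 2 4 8, .cite 4 1 2 4 8, .move 35 13 5, .move 38 8 12, .move 40 3 2,
      .cite 69 1 4 2 8, .move 46 3 1, .move 35 13 9, .move 45 4 13, .cite 26 8 2 1 4,
      .move 2 4 5, .cite 32 8 1 4 2, .cite 15 4 1 8 2, .cite 12 8 4 1 2, .cite 41 1 2 4 8,
      .cite 15 1 8 4 2, .move 2 3 7, .move 50 11 1, .move 51 7 4, .move 2 8 9, .cite 47 2 4 8 1,
      .move 11 14 6, .cite 9 1 2 4 8, .cite 9 4 2 8 1, .move 43 4 12, .cite 9 8 2 1 4,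
      .move 54 4 14, .move 2 4 7, .move 57 12 8, .move 60 5 3, .move 56 10 14, .move 56 2 6,
      .move 51 7 2, .cite 59 8 2 4 1, .move 50 11 2, .move 58 9 1, .move 55 8 11, .move 19 9 5,
      .move 52 14 8, .cite 0 1 2 4 8, .cite 59 1 2 8 4, .move 56 10 2, .move 56 10 6,
      .move 3 1 3, .move 17 11 10, .move 18 3 6, .cite 66 4 8 2 1, .move 66 1 7, .move 57 12 6,
      .move 5 4 6, .move 9 5 12, .cite 66 8 1 2 4, .move 67 1 13, .move 44 4 12, .move 5 9 1,
      .move 7 6 10, .cite 63 2 1 8 4, .cite 59 4 2 1 8, .move 79 1 7, .move 34 14 10,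
      .move 81 14 12, .cite 3 1 2 4 8, .move 71 7 5, .move 82 12 8, .move 6 13 12, .move 20 12 9,
      .move 4 10 11, .move 70 8 9, .move 47 7 5, .cite 2 1 2 4 8, .move 3 8 10, .cite 55 8 2 1 4,
      .cite 1 1 2 4 8, .move 86 14 12]),
   ([
      ⟨[1, 2, 3, 4, 8, 12], 13, 3⟩, ⟨[1, 2, 4, 6, 8, 9], 1, 1⟩, ⟨[1, 2, 4, 5, 8, 10], 13, 3⟩,
      ⟨[1, 2, 4, 5, 8, 10], 7, 3⟩, ⟨[1, 2, 4, 5, 8, 10], 14, 3⟩],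
    [
      .cite 81 1 2 4 8, .move 0 5 1, .cite 33 1 4 8 2, .cite 79 4 1 8 2, .move 3 10 11,
      .cite 0 1 2 4 8, .move 0 5 4, .move 1 2 11, .cite 79 4 2 8 1, .move 0 1 11, .move 0 2 10,
      .move 7 10 14, .move 1 9 11, .move 8 5 1, .move 12 10 6, .move 5 6 2, .cite 70 2 1 8 4,
      .move 13 9 1, .move 14 10 2, .cite 51 4 2 8 1, .cite 26 1 8 2 4, .move 2 1 3, .move 2 12 8,
      .move 17 3 11, .cite 70 1 4 2 8, .cite 26 4 1 2 8, .move 19 3 1]),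
   ([
      ⟨[1, 2, 4, 6, 8, 9], 1, 1⟩, ⟨[1, 2, 4, 6, 8, 9], 4, 1⟩, ⟨[1, 4, 6, 8, 9, 10], 2, 2⟩,
      ⟨[2, 4, 5, 8, 9, 10], 6, 2⟩],
    [
      .move 2 1 11, .cite 94 8 4 1 2, .cite 87 8 4 2 1, .cite 86 8 1 2 4, .move 2 2 10,
      .cite 94 8 4 2 1, .cite 57 1 8 4 2, .cite 89 8 1 2 4, .move 2 2 14, .cite 95 4 8 1 2,
      .cite 87 8 4 1 2, .cite 81 4 8 2 1, .move 1 10 8, .move 2 6 10, .cite 89 8 4 1 2,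
      .move 4 1 7, .move 13 1 5, .move 4 6 14, .cite 62 4 2 1 8, .move 0 9 8, .move 15 7 2,
      .move 0 9 13, .move 0 9 12, .move 15 7 4, .move 15 7 3, .move 20 8 11, .move 7 2 7,
      .cite 62 4 1 2 8, .move 19 2 1, .cite 68 8 1 2 4, .move 8 13 8, .move 22 7 3,
      .move 17 2 10, .move 14 6 3, .move 17 2 3, .move 12 6 10, .move 24 9 5, .move 5 3 1,
      .move 25 4 14, .move 5 8 12, .cite 60 8 2 4 1, .move 25 4 12, .move 23 10 8, .move 6 5 4,
      .move 9 5 4, .move 29 10 9, .move 27 5 1, .move 28 10 9, .move 16 14 12, .move 11 1 9]),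
   ([
      ⟨[1, 2, 3, 4, 8, 12], 2, 1⟩, ⟨[1, 2, 4, 6, 8, 9], 4, 1⟩, ⟨[1, 2, 4, 5, 8, 10], 7, 3⟩,
      ⟨[1, 2, 4, 5, 8, 10], 14, 3⟩],
    [
      .cite 82 4 1 8 2, .cite 83 2 1 8 4, .cite 35 2 4 1 8, .move 0 5 9, .move 2 1 13,
      .cite 81 4 1 8 2, .move 1 2 11, .move 7 6 2, .cite 35 2 8 1 4, .move 5 2 6, .move 8 9 5,
      .move 2 12 13, .move 0 1 9, .cite 81 2 4 8 1, .cite 0 1 2 4 8, .move 6 3 1,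
      .cite 1 2 8 4 1, .cite 3 8 4 2 1, .move 13 12 14, .move 9 9 1, .move 1 2 3,
      .cite 35 8 2 1 4, .move 9 2 6, .cite 66 4 8 1 2, .move 3 6 2, .move 18 9 12, .move 15 7 14,
      .move 17 7 1, .move 20 6 2, .cite 2 8 4 2 1, .cite 16 1 2 8 4]),
   ([
      ⟨[1, 2, 3, 4, 8, 12], 14, 3⟩, ⟨[1, 2, 3, 4, 8, 12], 13, 3⟩, ⟨[1, 2, 4, 6, 8, 9], 14, 3⟩,
      ⟨[1, 2, 4, 6, 8, 9], 4, 1⟩, ⟨[1, 2, 4, 5, 8, 10], 14, 3⟩],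
    [
      .cite 82 4 1 8 2, .cite 2 4 1 8 2, .move 1 2 11, .cite 84 2 1 8 4, .move 2 12 8,
      .move 2 1 3, .cite 82 4 1 2 8, .cite 73 1 4 2 8, .move 1 9 11, .move 4 8 12, .move 7 3 1,
      .move 2 8 11, .move 6 12 8, .move 4 3 11, .move 3 6 2, .move 12 9 5, .move 12 9 8,
      .move 10 3 6, .cite 23 8 1 2 4, .cite 54 4 2 1 8]),
   ([
      ⟨[1, 2, 3, 4, 8, 12], 4, 1⟩, ⟨[1, 2, 3, 4, 8, 12], 1, 1⟩, ⟨[1, 2, 3, 4, 8, 12], 13, 3⟩,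
      ⟨[1, 2, 4, 6, 8, 9], 14, 3⟩, ⟨[1, 2, 4, 8, 11, 12], 9, 3⟩, ⟨[1, 2, 4, 8, 8, 11], 9, 3⟩,
      ⟨[1, 2, 4, 5, 8, 11], 9, 3⟩, ⟨[1, 2, 4, 6, 8, 11], 4, 1⟩, ⟨[1, 2, 4, 6, 8, 9], 13, 3⟩,
      ⟨[1, 2, 4, 5, 8, 10], 14, 3⟩],
    [
      .move 6 3 11, .cite 83 4 1 2 8, .cite 37 1 4 2 8, .move 6 8 11, .cite 85 4 1 2 8,
      .move 7 12 8, .cite 9 1 4 8 2, .cite 10 1 4 8 2, .move 8 3 7, .move 5 12 8,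
      .cite 55 4 2 1 8]),
   ([
      ⟨[1, 2, 4, 5, 8, 10], 7, 3⟩, ⟨[1, 2, 4, 6, 8, 9], 4, 1⟩, ⟨[1, 2, 4, 6, 8, 9], 14, 3⟩,
      ⟨[1, 2, 4, 5, 8, 10], 14, 3⟩],
    [
      .cite 2 1 2 4 8, .cite 86 2 1 8 4, .move 1 9 3, .cite 1 1 2 4 8, .move 1 2 11,
      .move 1 9 11, .move 3 4 12, .cite 84 4 1 8 2, .move 4 6 2, .move 7 9 8, .move 1 1 3,
      .move 7 9 12, .move 7 9 5, .cite 3 1 4 8 2, .cite 0 1 2 4 8, .move 2 12 6,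
      .cite 25 2 8 1 4, .move 2 4 6, .move 3 1 9, .cite 3 4 1 8 2]),
   ([
      ⟨[1, 2, 4, 6, 8, 9], 4, 1⟩, ⟨[1, 2, 4, 6, 8, 9], 14, 3⟩, ⟨[1, 2, 4, 5, 8, 10], 14, 3⟩],
    [
      .cite 39 4 1 2 8, .cite 87 2 1 8 4, .cite 87 2 1 4 8, .cite 85 8 1 4 2, .cite 0 1 2 4 8,
      .cite 3 2 4 8 1, .move 0 5 7, .move 1 2 11, .cite 39 4 8 2 1, .cite 39 8 4 2 1,
      .move 0 2 7, .move 1 9 11, .cite 3 2 8 4 1, .cite 85 4 1 8 2, .move 6 6 2,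
      .cite 12 4 8 2 1, .cite 39 8 1 2 4, .move 4 3 2, .cite 12 8 4 2 1, .move 8 9 5,
      .move 3 10 2, .cite 12 4 8 1 2, .move 7 6 7, .move 9 12 13, .cite 12 8 4 1 2, .move 11 5 9,
      .move 11 5 13, .move 5 7 5, .move 7 1 9, .cite 70 8 4 2 1, .move 13 11 9, .move 17 11 2,
      .move 0 10 11, .move 12 7 6, .move 10 11 10, .move 18 9 1, .cite 26 2 1 8 4,
      .cite 20 2 8 4 1]),
   ([
      ⟨[1, 2, 4, 5, 8, 10], 8, 1⟩, ⟨[1, 2, 4, 6, 8, 9], 14, 3⟩, ⟨[1, 2, 4, 5, 8, 10], 14, 3⟩],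
    [
      .move 0 5 7, .cite 88 2 1 4 8, .move 0 5 3, .move 0 1 3, .move 3 8 12, .move 0 2 7,
      .cite 0 1 2 4 8, .cite 86 8 1 4 2, .cite 4 1 2 8 4, .move 6 10 2, .move 8 5 12,
      .move 8 5 9, .cite 3 1 2 8 4, .move 8 5 4, .cite 2 1 2 8 4, .move 7 8 10, .cite 5 1 8 4 2,
      .move 7 12 10, .cite 27 2 4 1 8, .move 3 1 5, .cite 5 8 1 4 2]),
   ([
      ⟨[1, 2, 4, 6, 8, 9], 13, 3⟩, ⟨[1, 2, 3, 4, 8, 12], 11, 3⟩, ⟨[1, 2, 3, 4, 8, 12], 1, 1⟩,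
      ⟨[1, 2, 4, 5, 8, 10], 7, 3⟩, ⟨[1, 2, 4, 6, 8, 9], 11, 3⟩, ⟨[1, 2, 4, 6, 8, 9], 14, 3⟩],
    [
      .move 0 4 5, .cite 4 4 2 1 8, .cite 89 1 4 8 2, .move 0 6 5, .cite 28 1 2 4 8,
      .move 4 8 10, .cite 6 4 8 2 1]),
   ([
      ⟨[1, 2, 3, 4, 8, 12], 11, 3⟩, ⟨[1, 2, 3, 4, 8, 12], 1, 1⟩, ⟨[1, 2, 4, 6, 8, 9], 14, 3⟩,
      ⟨[1, 2, 4, 5, 8, 10], 14, 3⟩],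
    [
      .cite 2 1 2 4 8, .cite 90 1 4 8 2, .cite 1 1 2 4 8, .move 0 10 9, .cite 0 1 2 4 8,
      .move 3 4 6, .move 0 8 9, .cite 8 2 8 1 4, .cite 7 8 4 2 1, .cite 6 4 8 2 1,
      .cite 8 1 8 4 2]),
   ([
      ⟨[1, 2, 3, 4, 8, 12], 1, 1⟩, ⟨[1, 2, 4, 6, 8, 9], 14, 3⟩, ⟨[1, 2, 4, 5, 8, 10], 14, 3⟩],
    [
      .cite 3 1 2 4 8, .cite 0 1 2 4 8, .cite 91 1 4 8 2, .move 1 4 5, .cite 2 1 2 4 8,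
      .move 1 6 5, .cite 7 8 4 2 1, .move 4 8 10, .cite 6 2 8 4 1, .cite 9 1 4 8 2,
      .cite 8 4 8 2 1]),
   ([
      ⟨[1, 2, 4, 5, 8, 10], 14, 3⟩, ⟨[1, 2, 4, 6, 8, 9], 14, 3⟩],
    [
      .cite 3 1 2 8 4, .cite 4 1 2 8 4, .cite 0 1 2 4 8, .cite 3 1 4 8 2, .cite 4 1 4 8 2,
      .cite 4 1 8 4 2, .cite 3 8 1 2 4, .cite 38 8 4 1 2]),
   ([
      ⟨[1, 2, 4, 6, 8, 9], 14, 3⟩],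
    [
      .cite 93 1 4 8 2, .cite 93 4 1 2 8, .cite 93 2 1 4 8, .cite 93 1 2 8 4, .cite 0 1 2 4 8,
      .cite 1 1 4 2 8, .cite 5 4 2 1 8, .cite 4 2 4 8 1, .cite 1 8 1 2 4, .cite 5 8 2 1 4]),
   ([
      ⟨[1, 2, 4, 6, 8, 9], 8, 1⟩],
    [
      .cite 94 1 2 4 8, .cite 0 1 2 4 8]),
   ([
      ⟨[1, 2, 3, 4, 8, 12], 14, 3⟩],
    [
      .cite 0 4 2 8 1, .cite 1 1 2 4 8, .cite 3 1 8 2 4]),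
   ([],
    [
      .cite 1 8 1 2 4, .cite 1 2 1 8 4, .cite 0 4 1 2 8, .cite 4 4 1 2 8])]

theorem checkRefutation_seatRefutation : checkRefutation [] seatRefutation = true := by
  decide +kernel

theorem not_isSeatFunction (s : List ℕ → ℕ → ℕ) : ¬ IsSeatFunction s :=
  not_isSeatFunction_of_checkRefutation seatRefutation
    (fun _ h => absurd h List.not_mem_nil) checkRefutation_seatRefutation s

/-! ### Rules on multisets of ballots -/

theorem count_map_univ {α β : Type*} [Fintype α] [DecidableEq β] (A : α → β) (b : β) :
    (Finset.univ.val.map A).count b = Finset.card {i | A i = b} := by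
  simp only [Multiset.count_map, Finset.card, Finset.filter_val, eq_comm]

theorem exists_perm_of_map_univ_eq {α β : Type*} [Fintype α] {A B : α → β}
    (h : Finset.univ.val.map A = Finset.univ.val.map B) :
    ∃ π : Equiv.Perm α, ∀ i, A i = B (π i) := by
  classical
  have hcard (b : β) : Nonempty ({i // A i = b} ≃ {i // B i = b}) := by
    refine ⟨Fintype.equivOfCardEq ?_⟩
    have := congrArg (Multiset.count b) h
    rw [count_map_univ, count_map_univ] at this
    simpa only [Fintype.card_subtype] using this
  exact ⟨Equiv.ofFiberEquiv fun b => (hcard b).some, fun i => (Equiv.ofFiberEquiv_map _ i).symm⟩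

section MultisetRule

variable {P : Type*} [Fintype P] {n k : ℕ}
  {f : (Fin n → Finset P) → Multiset P}

/-- The committee that an anonymous rule chooses for a multiset of `n` ballots. -/
noncomputable def multisetRule (f : (Fin n → Finset P) → Multiset P) (M : Multiset (Finset P)) :
    Multiset P :=
  f fun i => M.toList.getD i Finset.univ

/-- A multiset that lists the ballots of `n` voters. -/
def IsBallotMultiset (n : ℕ) (M : Multiset (Finset P)) : Prop :=
  M.card = n ∧ ∀ X ∈ M, X.Nonempty

theorem IsBallotMultiset.exists_profile {M : Multiset (Finset P)} (hM : IsBallotMultiset n M) :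
    ∃ A, ValidProfile n A ∧ Finset.univ.val.map A = M ∧ multisetRule f M = f A := by
  have hlen : M.toList.length = n := by rw [Multiset.length_toList, hM.1]
  subst hlen
  refine ⟨fun i => M.toList[i], fun i => ?_, ?_, ?_⟩
  · exact hM.2 _ (Multiset.mem_toList.1 (List.getElem_mem _))
  · rw [Fin.univ_val_map]
    exact (congrArg _ List.ofFn_getElem).trans M.coe_toList
  · exact congrArg f (funext fun i => List.getD_eq_getElem _ _ i.2)

theorem multisetRule_map (hf : Anonymous n f) {A : Fin n → Finset P} (hA : ValidProfile n A) :
    multisetRule f (Finset.univ.val.map A) = f A := by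
  have hM : IsBallotMultiset n (Finset.univ.val.map A) :=
    ⟨by simp, fun X hX => by
      obtain ⟨i, -, rfl⟩ := Multiset.mem_map.1 hX
      exact hA i⟩
  obtain ⟨B, -, hBA, hfB⟩ := hM.exists_profile (f := f)
  obtain ⟨π, hπ⟩ := exists_perm_of_map_univ_eq hBA
  rw [hfB, ← hf A hA π]
  exact congrArg f (funext hπ)

theorem card_multisetRule (hf : IsPAPPRule n k f) {M : Multiset (Finset P)}
    (hM : IsBallotMultiset n M) : (multisetRule f M).card = k := by
  obtain ⟨A, hA, -, hfA⟩ := hM.exists_profile (f := f)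
  rw [hfA, hf A hA]

variable [DecidableEq P]

theorem one_le_count_multisetRule (hf : WeakRep n k f) {M : Multiset (Finset P)}
    (hM : IsBallotMultiset n M) {x : P} (hx : n ≤ k * M.count {x}) :
    1 ≤ (multisetRule f M).count x := by
  obtain ⟨A, hA, hAM, hfA⟩ := hM.exists_profile (f := f)
  rw [hfA]
  refine hf A hA x {i | A i = {x}} ?_ fun i hi => (Finset.mem_filter.1 hi).2
  rwa [← hAM, count_map_univ] at hx

theorem seats_multisetRule_cons_le (hanon : Anonymous n f) (hf : Strategyproof n f)
    {M : Multiset (Finset P)} {X Y : Finset P} (hX : IsBallotMultiset n (X ::ₘ M))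
    (hY : Y.Nonempty) :
    seats (multisetRule f (Y ::ₘ M)) X ≤ seats (multisetRule f (X ::ₘ M)) X := by
  obtain ⟨A, hA, hAM, hfA⟩ := hX.exists_profile (f := f)
  obtain ⟨i, -, hi⟩ := Multiset.mem_map.1 (hAM ▸ Multiset.mem_cons_self X M)
  have hB : ValidProfile n (Function.update A i Y) := fun j => by
    obtain rfl | hj := eq_or_ne j i
    · simpa using hY
    · simpa [hj] using hA j
  have hval := Multiset.cons_erase (Finset.mem_univ_val i)
  have hBM : Finset.univ.val.map (Function.update A i Y) = Y ::ₘ M := by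
    rw [← hval, Multiset.map_cons] at hAM ⊢
    rw [hi, Multiset.cons_inj_right] at hAM
    rw [Function.update_self, ← hAM]
    congr 1
    refine Multiset.map_congr rfl fun j hj => Function.update_of_ne ?_ _ _
    exact ((Multiset.Nodup.mem_erase_iff Finset.univ.nodup).1 hj).1
  rw [← hBM, multisetRule_map hanon hB, hfA, ← hi]
  exact hf A _ hA hB i fun j hj => (Function.update_of_ne hj _ _).symm

theorem seats_multisetRule_replicate_add_le (hanon : Anonymous n f) (hf : Strategyproof n f)
    {X Y : Finset P} (hY : Y.Nonempty) (r : ℕ) {M : Multiset (Finset P)}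
    (hX : IsBallotMultiset n (.replicate r X + M)) :
    seats (multisetRule f (.replicate r Y + M)) X ≤
      seats (multisetRule f (.replicate r X + M)) X := by
  induction r generalizing M with
  | zero => rfl
  | succ r ih =>
    have hXY : IsBallotMultiset n (.replicate r X + Y ::ₘ M) := by
      refine ⟨by simpa [add_assoc, add_comm] using hX.1, fun Z hZ => ?_⟩
      rw [Multiset.mem_add, Multiset.mem_cons] at hZ
      obtain hZ | rfl | hZ := hZ
      · exact hX.2 Z (Multiset.mem_add.2 (.inl (Multiset.mem_of_le
          (Multiset.replicate_le_replicate _ |>.2 r.le_succ) hZ)))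
      · exact hY
      · exact hX.2 Z (Multiset.mem_add.2 (.inr hZ))
    rw [Multiset.replicate_succ, Multiset.cons_add] at hX
    rw [Multiset.replicate_succ, Multiset.replicate_succ, Multiset.cons_add, Multiset.cons_add,
      ← Multiset.add_cons]
    refine (ih hXY).trans ?_
    rw [Multiset.add_cons]
    exact seats_multisetRule_cons_le hanon hf hX hY

end MultisetRule

/-! ### From large elections to six voters and four parties -/

/-- The ballot coded by `X`, where the last of the four parties stands for all parties
from `3` on. -/
def decodeBallot (m X : ℕ) : Finset (Fin m) := {i | X.testBit (min i 3)}

/-- The ballot coded by `X`, or the full ballot if that is empty. -/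
def reportedBallot (m X : ℕ) : Finset (Fin m) :=
  if (decodeBallot m X).Nonempty then decodeBallot m X else Finset.univ

/-- Every voter of the profile `p` becomes `t` voters, and `2 * t` voters are added for each of the
parties in `E`. -/
def expandProfile {m : ℕ} (t : ℕ) (E : Finset (Fin m)) (p : List ℕ) :
    Multiset (Finset (Fin m)) :=
  (p.map fun x => Multiset.replicate t (reportedBallot m x)).sum +
    ∑ i ∈ E, Multiset.replicate (2 * t) {i}

/-- The seat counts of the four parties in the profile `p`, where one seat for every party in `E` is
not counted. -/
noncomputable def inducedSeats {m n : ℕ} (f : (Fin n → Finset (Fin m)) → Multiset (Fin m)) (t : ℕ)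
    (E : Finset (Fin m)) (p : List ℕ) (X : ℕ) : ℕ :=
  seats (multisetRule f (expandProfile t E p)) (decodeBallot m X) -
    if X.testBit 3 then E.card else 0

theorem reportedBallot_nonempty {m : ℕ} (hm : 4 ≤ m) (X : ℕ) : (reportedBallot m X).Nonempty := by
  rw [reportedBallot]
  split_ifs with h
  · exact h
  · exact ⟨⟨0, by omega⟩, Finset.mem_univ _⟩

theorem reportedBallot_eq {m : ℕ} (hm : 4 ≤ m) {X : ℕ} (hX : X < 16) (h0 : X ≠ 0) :
    reportedBallot m X = decodeBallot m X := by
  have hbit : ∀ X < 16, X ≠ 0 → ∃ j < 4, X.testBit j = true := by decide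
  obtain ⟨j, hj, hXj⟩ := hbit X hX h0
  refine if_pos ⟨⟨j, by omega⟩, ?_⟩
  simpa [decodeBallot, min_eq_left (Nat.le_of_lt_succ hj)] using hXj

theorem exists_seats_decodeBallot {m : ℕ} (W : Multiset (Fin m)) :
    ∃ a b c d, ∀ X, seats W (decodeBallot m X) = (if X.testBit 0 then a else 0) +
      (if X.testBit 1 then b else 0) + (if X.testBit 2 then c else 0) +
      (if X.testBit 3 then d else 0) := by
  let w (j : ℕ) : ℕ := ∑ i : Fin m with min i.val 3 = j, W.count i
  refine ⟨w 0, w 1, w 2, w 3, fun X => ?_⟩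
  have : seats W (decodeBallot m X) = ∑ j ∈ Finset.range 4, if X.testBit j then w j else 0 := by
    rw [seats, decodeBallot, Finset.sum_filter,
      ← Finset.sum_fiberwise_of_maps_to (g := fun i : Fin m => min i.val 3) (t := Finset.range 4)
        fun _ _ => Finset.mem_range.2 (by omega)]
    refine Finset.sum_congr rfl fun j _ => ?_
    rw [Finset.sum_congr rfl fun _ hi => by rw [(Finset.mem_filter.1 hi).2]]
    split_ifs <;> simp [w]
  simpa only [Finset.sum_range_succ, Finset.sum_range_zero, zero_add] using this

theorem card_le_seats {P : Type*} [DecidableEq P] {W : Multiset P} {T X : Finset P} (hTX : T ⊆ X)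
    (hT : ∀ i ∈ T, 1 ≤ W.count i) : T.card ≤ seats W X :=
  calc
    T.card = ∑ _i ∈ T, 1 := Finset.card_eq_sum_ones T
    _ ≤ ∑ i ∈ T, W.count i := Finset.sum_le_sum hT
    _ ≤ seats W X := Finset.sum_le_sum_of_subset hTX

set_option synthInstance.maxSize 1024 in
theorem exists_committeeCode {a b c d : ℕ} (h : a + b + c + d = 3) :
    ∃ e ∈ committeeCodes, ∀ X < 16, (if X.testBit 0 then a else 0) +
      (if X.testBit 1 then b else 0) + (if X.testBit 2 then c else 0) +
      (if X.testBit 3 then d else 0) = codedSeats e X := by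
  have key : ∀ a < 4, ∀ b < 4, ∀ c < 4, ∀ d < 4, a + b + c + d = 3 →
      ∃ e ∈ committeeCodes, ∀ X < 16, (if X.testBit 0 then a else 0) +
        (if X.testBit 1 then b else 0) + (if X.testBit 2 then c else 0) +
        (if X.testBit 3 then d else 0) = codedSeats e X := by
    decide +kernel
  exact key a (by omega) b (by omega) c (by omega) d (by omega) h

section Induced

variable {k m n t : ℕ} {E : Finset (Fin m)} {f : (Fin n → Finset (Fin m)) → Multiset (Fin m)}

theorem expandProfile_cons (x : ℕ) (p : List ℕ) :
    expandProfile t E (x :: p) = .replicate t (reportedBallot m x) + expandProfile t E p := by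
  simp [expandProfile, add_assoc]

theorem card_expandProfile (p : List ℕ) :
    (expandProfile t E p).card = p.length * t + E.card * (2 * t) := by
  induction p with
  | nil => simp [expandProfile]
  | cons x p ih => simp [expandProfile_cons, ih]; ring

theorem nonempty_of_mem_expandProfile (hm : 4 ≤ m) (p : List ℕ) :
    ∀ X ∈ expandProfile t E p, X.Nonempty := by
  induction p with
  | nil =>
    intro X hX
    simp only [expandProfile, List.map_nil, List.sum_nil, zero_add, Multiset.mem_sum] at hX
    obtain ⟨i, -, hi⟩ := hX
    exact Multiset.eq_of_mem_replicate hi ▸ Finset.singleton_nonempty i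
  | cons x p ih =>
    intro X hX
    rw [expandProfile_cons, Multiset.mem_add] at hX
    obtain hX | hX := hX
    · exact Multiset.eq_of_mem_replicate hX ▸ reportedBallot_nonempty hm x
    · exact ih X hX

theorem isBallotMultiset_expandProfile (hm : 4 ≤ m) (hn : n = 2 * (E.card + 3) * t) {p : List ℕ}
    (hp : p.length = 6) : IsBallotMultiset n (expandProfile t E p) :=
  ⟨by rw [card_expandProfile, hp, hn]; ring, nonempty_of_mem_expandProfile hm p⟩

theorem le_count_expandProfile (p : List ℕ) {i : Fin m} (hi : i ∈ E) :
    2 * t ≤ (expandProfile t E p).count {i} := by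
  rw [expandProfile, Multiset.count_add]
  refine le_add_left (Multiset.le_count_iff_replicate_le.2 ?_)
  exact Finset.single_le_sum (f := fun i : Fin m => Multiset.replicate (2 * t) ({i} : Finset _))
    (fun _ _ => Multiset.zero_le _) hi

theorem subset_decodeBallot (hE : ∀ i ∈ E, 3 < i.val) {X : ℕ} (hX : X.testBit 3 = true) :
    E ⊆ decodeBallot m X := fun i hi => by
  simpa [decodeBallot, min_eq_right (hE i hi).le] using hX

theorem isSeatFunction_inducedSeats (hm : 4 ≤ m) (hn : n = 2 * (E.card + 3) * t)
    (hE : ∀ i ∈ E, 3 < i.val) (hrule : IsPAPPRule n (E.card + 3) f) (hanon : Anonymous n f)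
    (hweak : WeakRep n (E.card + 3) f) (hsp : Strategyproof n f) :
    IsSeatFunction (inducedSeats f t E) := by
  have hquota {N : ℕ} (h : 2 * t ≤ N) : n ≤ (E.card + 3) * N := by
    rw [hn, mul_comm 2, mul_assoc]
    exact Nat.mul_le_mul_left _ h
  refine ⟨fun p q h => ?_, fun p X Y hp hX => ?_, fun p x hx hp => ?_, fun p hp => ?_⟩
  · have : expandProfile t E p = expandProfile t E q := by
      rw [expandProfile, expandProfile, (h.map _).sum_eq]
    unfold inducedSeats
    rw [this]
  · refine Nat.sub_le_sub_right ?_ _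
    obtain rfl | h0 := eq_or_ne X 0
    · simp [decodeBallot, seats]
    · have hball := isBallotMultiset_expandProfile (t := t) hm hn
        (show (X :: p).length = 6 by simp [hp])
      rw [expandProfile_cons, reportedBallot_eq hm hX h0] at hball
      rw [expandProfile_cons, expandProfile_cons, reportedBallot_eq hm hX h0]
      exact seats_multisetRule_replicate_add_le hanon hsp (reportedBallot_nonempty hm Y) t hball
  · obtain ⟨j, hj, hxj, h3, hx16, hx0⟩ : ∃ j < 4, x.testBit j = true ∧
        (x.testBit 3 = true → j = 3) ∧ x < 16 ∧ x ≠ 0 := by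
      revert x
      decide
    let y : Fin m := ⟨j, by omega⟩
    have hball := isBallotMultiset_expandProfile (t := t) hm hn
      (show (x :: x :: p).length = 6 by simp [hp])
    have hexp : expandProfile t E (x :: x :: p) =
        .replicate (2 * t) (decodeBallot m x) + expandProfile t E p := by
      rw [expandProfile_cons, expandProfile_cons, reportedBallot_eq hm hx16 hx0, ← add_assoc,
        ← Multiset.replicate_add, two_mul]
    have hball' : IsBallotMultiset n (.replicate (2 * t) {y} + expandProfile t E p) := by
      refine ⟨?_, fun X hX => ?_⟩
      · rw [← hball.1, hexp]
        simp
      · obtain hX | hX := Multiset.mem_add.1 hX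
        · exact Multiset.eq_of_mem_replicate hX ▸ Finset.singleton_nonempty y
        · exact nonempty_of_mem_expandProfile hm p X hX
    have hcounty := one_le_count_multisetRule hweak hball' (x := y) <| hquota <| by
      rw [Multiset.count_add, Multiset.count_replicate_self]
      exact Nat.le_add_right _ _
    have hcount (i) (hi : i ∈ E) := one_le_count_multisetRule hweak hball' (x := i) <| hquota <| by
      rw [Multiset.count_add]
      exact le_add_left (le_count_expandProfile p hi)
    have hy : y ∈ decodeBallot m x := by
      simpa [decodeBallot, y, min_eq_left (Nat.le_of_lt_succ hj)] using hxj
    rw [hexp] at hball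
    refine Nat.le_sub_of_add_le (le_trans ?_ (hexp ▸
      seats_multisetRule_replicate_add_le hanon hsp (Finset.singleton_nonempty y) _ hball))
    split_ifs with hx3
    · have hyE : y ∉ E := fun h => by
        have := hE y h
        simp [y, h3 hx3] at this
      rw [add_comm, ← Finset.card_insert_of_notMem hyE]
      exact card_le_seats (Finset.insert_subset hy (subset_decodeBallot hE hx3))
        (Finset.forall_mem_insert _ _ _ |>.2 ⟨hcounty, hcount⟩)
    · rw [add_zero, ← Finset.card_singleton y]
      exact card_le_seats (Finset.singleton_subset_iff.2 hy) (by simpa using hcounty)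
  · have hball := isBallotMultiset_expandProfile (t := t) hm hn hp
    have hcard := card_multisetRule hrule hball
    have hlast : E.card ≤ seats (multisetRule f (expandProfile t E p)) (decodeBallot m 8) :=
      card_le_seats (subset_decodeBallot hE (by decide)) fun i hi =>
        one_le_count_multisetRule hweak hball (hquota (le_count_expandProfile p hi))
    have hall : seats (multisetRule f (expandProfile t E p)) (decodeBallot m 15) = E.card + 3 := by
      rw [← hcard, ← Multiset.sum_count_eq_card fun i _ => Finset.mem_univ i, seats]
      refine Finset.sum_congr (Finset.eq_univ_of_forall fun i => ?_) fun _ _ => rfl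
      have hbit : ∀ j < 4, Nat.testBit 15 j = true := by decide
      simpa [decodeBallot] using hbit (min i 3) (by omega)
    obtain ⟨a, b, c, d, hseats⟩ :=
      exists_seats_decodeBallot (multisetRule f (expandProfile t E p))
    rw [hseats] at hlast hall
    have hlast' : E.card ≤ d := by simpa [Nat.testBit] using hlast
    have hall' : a + b + c + d = E.card + 3 := by simpa [Nat.testBit] using hall
    obtain ⟨d, rfl⟩ := Nat.exists_eq_add_of_le hlast'
    obtain ⟨e, he, h⟩ := exists_committeeCode (a := a) (b := b) (c := c) (d := d) (by omega)
    refine ⟨e, he, fun X hX => ?_⟩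
    rw [← h X hX, inducedSeats, hseats]
    split_ifs <;> omega

end Induced

/-- For all integers `k ≥ 3`, `m ≥ k+1`, `n ≥ 1` with `2k ∣ n`,
no party-approval rule for `n` voters, `m` parties, and committee size `k`
simultaneously satisfies anonymity, weak representation, and strategyproofness. -/
theorem no_anonymous_weakRep_strategyproof_papp_rule
    (k m n : ℕ) (hk : 3 ≤ k) (hm : k + 1 ≤ m) (hn : 1 ≤ n) (hdvd : 2 * k ∣ n) :
    ¬ ∃ f : (Fin n → Finset (Fin m)) → Multiset (Fin m),
        IsPAPPRule n k f ∧ Anonymous n f ∧ WeakRep n k f ∧ Strategyproof n f := by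
  rintro ⟨f, hrule, hanon, hweak, hsp⟩
  obtain ⟨t, rfl⟩ := hdvd
  obtain ⟨E, hE, rfl⟩ : ∃ E : Finset (Fin m), (∀ i ∈ E, 3 < i.val) ∧ k = E.card + 3 :=
    ⟨.Ioc ⟨3, by omega⟩ ⟨k, by omega⟩, fun i hi => (Finset.mem_Ioc.1 hi).1, by
      rw [Fin.card_Ioc]
      exact (Nat.sub_add_cancel hk).symm⟩
  exact not_isSeatFunction _
    (isSeatFunction_inducedSeats (by omega) rfl hE hrule hanon hweak hsp)
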